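/- arXiv:2405.05939 — 2 statements merged into one kernel-verified Lean document; each statement's English description precedes it below -/
import Mathlib

section
/- Let $G$ be a finitely generated nilpotent group such that $[G,G]$ is infinite cyclic, and let $x_1, \dots, x_n \in G$. Let $b \ge 1$ be such that $[x_i, x_j] \in \{z^k : |k| \le b\}$ for all $i,j$, where $z$ generates $[G,G]$. Then the submonoid $M = \{x_1, \dots, x_n\}^*$ generated by $x_1,\dots,x_n$ satisfies $M = \left(\bigcup_{i=1}^n x_i^*\right)^{4n(b^2+1)}$, i.e., every element of $M$ is a product of at most $4n(b^2+1)$ powers $x_i^{e}$ with $e \ge 0$. -/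
/-- The commutator `[x, y] = x⁻¹ y⁻¹ x y`. -/
def commE {G : Type*} [Group G] (x y : G) : G := x⁻¹ * y⁻¹ * x * y

/-- The `N`-fold (ordered) product set of `A`. -/
def foldProd {G : Type*} [Group G] (N : ℕ) (A : Set G) : Set G :=
  {t | ∃ s : Fin N → G, (∀ i, s i ∈ A) ∧ (List.ofFn s).prod = t}

namespace Stmt9

/-- Zero-sum extraction modulo `d`. -/
lemma extract (d : ℕ) (hd : 1 ≤ d) : ∀ (k : ℕ) (F : List ℤ), F.length ≤ k →
    ∃ E H : List ℤ, F.Perm (E ++ H) ∧ E.length < d ∧ (d : ℤ) ∣ H.sum := by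
  intro k
  induction k with
  | zero =>
    intro F hF
    exact ⟨F, [], by simp, by omega, by simp⟩
  | succ k ih =>
    intro F hF
    by_cases hlt : F.length < d
    · exact ⟨F, [], by simp, hlt, by simp⟩
    · have : NeZero d := ⟨by omega⟩
      obtain ⟨i, j, hij, he⟩ := Fintype.exists_ne_map_eq_of_card_lt
        (fun k : Fin (d + 1) => (((F.take k).sum : ℤ) : ZMod d)) (by simp [ZMod.card])
      wlog hlt' : i < j generalizing i j
      · exact this j i hij.symm he.symm (lt_of_le_of_ne (not_lt.mp hlt') hij.symm)
      have hlt2 : (i : ℕ) < j := hlt'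
      have hj : (j : ℕ) ≤ d := by omega
      obtain ⟨t1, t2, t3, h1, h2, h3⟩ : ∃ t1 t2 t3 : List ℤ, F = t1 ++ t2 ++ t3 ∧
          F.take i = t1 ∧ F.take j = t1 ++ t2 := by
        refine ⟨F.take i, (F.take j).drop i, F.drop j, ?_, rfl, ?_⟩
        · conv_lhs => rw [← List.take_append_drop j F, ← List.take_append_drop i (F.take j)]
          rw [List.take_take, min_eq_left hlt2.le]
        · conv_lhs => rw [← List.take_append_drop i (F.take j)]
          rw [List.take_take, min_eq_left hlt2.le]
      have l1 : t1.length = i := by rw [← h2, List.length_take]; omega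
      have l2 : t1.length + t2.length = j := by
        rw [← List.length_append, ← h3, List.length_take]; omega
      have hdv : (d : ℤ) ∣ t2.sum := by
        rw [← ZMod.intCast_zmod_eq_zero_iff_dvd]
        simp only [h2, h3, List.sum_append] at he
        push_cast at he
        simpa using he
      obtain ⟨E, H, hp, hE, hH⟩ := ih (t1 ++ t3) (by
        rw [h1] at hF; simp at hF ⊢; omega)
      refine ⟨E, t2 ++ H, ?_, hE, by rw [List.sum_append]; exact dvd_add hdv hH⟩
      rw [h1]
      have p1 : (t1 ++ t2 ++ t3).Perm (t2 ++ (t1 ++ t3)) := by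
        rw [← List.append_assoc]
        exact List.Perm.append_right _ List.perm_append_comm
      have p2 : (t2 ++ (E ++ H)).Perm (E ++ (t2 ++ H)) := by
        rw [← List.append_assoc, ← List.append_assoc]
        exact List.Perm.append_right _ List.perm_append_comm
      exact p1.trans ((List.Perm.append_left _ hp).trans p2)

/-- Few-positions lemma, normalised lower half. -/
lemma core0 (b : ℕ) (S : Set ℤ) (L : ℤ) (hL : 0 < L) (h0 : (0:ℤ) ∈ S) (hLS : L ∈ S)
    (hS : ∀ v ∈ S, 0 ≤ v ∧ v ≤ L) (hb : 1 ≤ b)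
    (hP : ∀ r, 0 ≤ r → r ≤ L → ∃ v ∈ S, r - b < v ∧ v ≤ r)
    (F : List ℤ) (hF : ∀ v ∈ F, v ∈ S) (hlen : 6 * b ≤ F.length)
    (hhalf : 2 * F.sum ≤ L * F.length) :
    ∃ cs : List (ℤ × ℕ), cs.length ≤ b + 3 ∧ (∀ p ∈ cs, p.1 ∈ S) ∧
      (cs.map (·.2)).sum = F.length ∧ (cs.map (fun p => (p.2 : ℤ) * p.1)).sum = F.sum := by
  obtain ⟨d, hdS, hd1, hdb⟩ : ∃ d : ℕ, (d : ℤ) ∈ S ∧ 1 ≤ d ∧ d ≤ b := by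
    by_cases h : (b : ℤ) ≤ L
    · obtain ⟨v, hv, h1, h2⟩ := hP b (by positivity) h
      obtain ⟨d, rfl⟩ := Int.eq_ofNat_of_zero_le (show 0 ≤ v by omega)
      exact ⟨d, hv, by omega, by omega⟩
    · obtain ⟨d, rfl⟩ := Int.eq_ofNat_of_zero_le hL.le
      exact ⟨d, hLS, by omega, by omega⟩
  obtain ⟨E, H, hp, hE, q, hq⟩ := extract d hd1 _ F le_rfl
  have hEm : ∀ v ∈ E, v ∈ S := fun v hv => hF v (hp.mem_iff.2 (by simp [hv]))
  have hHm : ∀ v ∈ H, v ∈ S := fun v hv => hF v (hp.mem_iff.2 (by simp [hv]))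
  have hE0 : 0 ≤ E.sum := List.sum_nonneg fun v hv => (hS v (hEm v hv)).1
  have hH0 : 0 ≤ H.sum := List.sum_nonneg fun v hv => (hS v (hHm v hv)).1
  have hsum : F.sum = E.sum + H.sum := by rw [hp.sum_eq, List.sum_append]
  have hln : F.length = E.length + H.length := by rw [hp.length_eq, List.length_append]
  have hd0 : (0 : ℤ) < d := by exact_mod_cast hd1
  have hq0 : 0 ≤ q := by
    rw [hq] at hH0
    exact nonneg_of_mul_nonneg_right hH0 hd0
  obtain ⟨s, hs⟩ := Int.eq_ofNat_of_zero_le (Int.ediv_nonneg hq0 hL.le)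
  have hr0 := Int.emod_nonneg q hL.ne'
  have hr1 := Int.emod_lt_of_pos q hL
  have hdiv := Int.emod_add_mul_ediv q L
  rw [hs] at hdiv
  obtain ⟨v, hvS, hv1, hv2⟩ := hP (q % L) hr0 hr1.le
  obtain ⟨e, he⟩ := Int.eq_ofNat_of_zero_le (show 0 ≤ q % L - v by omega)
  have hq' : q = v + e + L * s := by linarith
  have hv0 := (hS v hvS).1
  have hds : 2 * (d * s) ≤ F.length := by
    have h1 : L * (2 * (d * s) : ℤ) ≤ L * F.length := by
      have : (d:ℤ) * (L * s) ≤ d * q := by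
        apply mul_le_mul_of_nonneg_left _ hd0.le
        rw [hq']; have : (0:ℤ) ≤ e := by positivity
        linarith
      have h3 : L * (2 * (d * s) : ℤ) = 2 * (d * (L * s)) := by ring
      rw [h3]; linarith
    have := le_of_mul_le_mul_left h1 hL
    exact_mod_cast this
  have heb : e < b := by omega
  obtain ⟨rest, hrest⟩ : ∃ rest, H.length = d * s + d + e + rest :=
    Nat.exists_eq_add_of_le (by omega)
  refine ⟨E.map (fun v => (v, 1)) ++ [(L, d * s), (v, d), ((d : ℤ), e), (0, rest)], ?_, ?_, ?_, ?_⟩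
  · simp; omega
  · intro p hp
    simp only [List.mem_append, List.mem_map, List.mem_cons, List.not_mem_nil, or_false] at hp
    rcases hp with ⟨v, hv, rfl⟩ | rfl | rfl | rfl | rfl
    · exact hEm v hv
    all_goals assumption
  · have : (fun (_ : ℤ) => 1) = Function.const ℤ 1 := rfl
    simp [Function.comp_def]
    omega
  · simp [Function.comp_def]
    rw [hsum, hq, hq']
    ring

lemma sum_affine (c s : ℤ) (cs : List (ℤ × ℕ)) :
    ((cs.map (fun p => (c + s * p.1, p.2))).map (fun p => (p.2 : ℤ) * p.1)).sum =
      c * ((cs.map (·.2)).sum : ℕ) + s * (cs.map (fun p => (p.2 : ℤ) * p.1)).sum := by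
  induction cs with
  | nil => simp
  | cons a t ih =>
    simp only [List.map_cons, List.sum_cons, ih]
    push_cast
    ring

lemma sum_affine' (c s : ℤ) (F : List ℤ) :
    (F.map (fun v => c + s * v)).sum = c * F.length + s * F.sum := by
  induction F with
  | nil => simp
  | cons a t ih =>
    simp only [List.map_cons, List.sum_cons, ih, List.length_cons]
    push_cast
    ring

lemma core (b : ℕ) (S : Set ℤ) (hfin : S.Finite) (hb : 1 ≤ b)
    (hP : ∀ p ∈ S, ∀ q ∈ S, ∀ r, p ≤ r → r ≤ q → ∃ v ∈ S, r - b < v ∧ v ≤ r)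
    (F : List ℤ) (hF : ∀ v ∈ F, v ∈ S) (hlen : 6 * b ≤ F.length) :
    ∃ cs : List (ℤ × ℕ), cs.length ≤ b + 3 ∧ (∀ p ∈ cs, p.1 ∈ S) ∧
      (cs.map (·.2)).sum = F.length ∧ (cs.map (fun p => (p.2 : ℤ) * p.1)).sum = F.sum := by
  have hne : S.Nonempty := by
    cases F with
    | nil => simp at hlen; omega
    | cons a t => exact ⟨a, hF a (by simp)⟩
  obtain ⟨m, hm, hmin⟩ := Set.exists_min_image S id hfin hne
  obtain ⟨M, hM, hmax⟩ := Set.exists_max_image S id hfin hne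
  simp only [id] at hmin hmax
  by_cases hmM : m = M
  · refine ⟨[(m, F.length)], by simp, by simpa using hm, by simp, ?_⟩
    have : F = List.replicate F.length m :=
      List.eq_replicate_of_mem fun v hv =>
        le_antisymm (by rw [hmM]; exact hmax v (hF v hv)) (hmin v (hF v hv))
    conv_rhs => rw [this]
    simp
  have hlt : m < M := lt_of_le_of_ne (hmin M hM) hmM
  by_cases hh : 2 * F.sum ≤ (m + M) * F.length
  · obtain ⟨cs, h1, h2, h3, h4⟩ := core0 b {v | m + v ∈ S} (M - m) (by omega)
      (by simpa using hm) (by simpa using hM)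
      (fun v hv => by have a1 := hmin _ hv; have a2 := hmax _ hv; constructor <;> omega) hb
      (fun r hr1 hr2 => by
        obtain ⟨v, hv, a1, a2⟩ := hP m hm M hM (m + r) (by omega) (by omega)
        exact ⟨v - m, by simpa using hv, by omega, by omega⟩)
      (F.map (fun v => -m + 1 * v))
      (fun v hv => by
        simp only [List.mem_map] at hv
        obtain ⟨u, hu, rfl⟩ := hv
        simpa using hF u hu) (by simpa using hlen)
      (by rw [sum_affine', List.length_map]; linarith)
    refine ⟨cs.map (fun p => (m + 1 * p.1, p.2)), by simpa using h1, ?_, ?_, ?_⟩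
    · intro p hp
      simp only [List.mem_map] at hp
      obtain ⟨u, hu, rfl⟩ := hp
      simpa using h2 u hu
    · simpa [Function.comp_def] using h3
    · rw [sum_affine, h3, h4, sum_affine', List.length_map]; ring
  · obtain ⟨cs, h1, h2, h3, h4⟩ := core0 b {v | M - v ∈ S} (M - m) (by omega)
      (by simpa using hM) (by simpa using hm)
      (fun v hv => by have a1 := hmin _ hv; have a2 := hmax _ hv; constructor <;> omega) hb
      (fun r hr1 hr2 => by
        by_cases hc : M - r + b - 1 ≤ M
        · obtain ⟨v, hv, a1, a2⟩ := hP m hm M hM (M - r + b - 1) (by omega) hc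
          exact ⟨M - v, by simpa using hv, by omega, by omega⟩
        · exact ⟨0, by simpa using hM, by omega, by omega⟩)
      (F.map (fun v => M + (-1) * v))
      (fun v hv => by
        simp only [List.mem_map] at hv
        obtain ⟨u, hu, rfl⟩ := hv
        simpa using hF u hu) (by simpa using hlen)
      (by rw [sum_affine', List.length_map]; linarith)
    refine ⟨cs.map (fun p => (M + (-1) * p.1, p.2)), by simpa using h1, ?_, ?_, ?_⟩
    · intro p hp
      simp only [List.mem_map] at hp
      obtain ⟨u, hu, rfl⟩ := hp
      simpa [sub_eq_add_neg] using h2 u hu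
    · simpa [Function.comp_def] using h3
    · rw [sum_affine, h3, h4, sum_affine', List.length_map]; ring

/-- Expand a list of syllables to a word. -/
def flat {n : ℕ} (l : List (Fin n × ℕ)) : List (Fin n) :=
  l.flatMap (fun p => List.replicate p.2 p.1)

lemma flat_cons {n : ℕ} (p : Fin n × ℕ) (l) : flat (p :: l) = List.replicate p.2 p.1 ++ flat l := by
  simp [flat]

lemma flat_append {n : ℕ} (l l' : List (Fin n × ℕ)) : flat (l ++ l') = flat l ++ flat l' := by
  simp [flat]

lemma flat_split {n : ℕ} (l : List (Fin n × ℕ)) : ∀ w1 w2, flat l = w1 ++ w2 →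
    ∃ l1 l2, flat l1 = w1 ∧ flat l2 = w2 ∧ l1.length + l2.length ≤ l.length + 1 := by
  induction l with
  | nil =>
    intro w1 w2 h
    have : w1 = [] ∧ w2 = [] := by simpa [flat] using h.symm
    obtain ⟨rfl, rfl⟩ := this
    exact ⟨[], [], rfl, rfl, by simp⟩
  | cons p l ih =>
    intro w1 w2 h
    rw [flat_cons, List.append_eq_append_iff] at h
    rcases h with ⟨t, h1, h2⟩ | ⟨t, h1, h2⟩
    · obtain ⟨l1, l2, a, c, e⟩ := ih _ _ h2
      exact ⟨p :: l1, l2, by rw [flat_cons, a, h1], c, by simp; omega⟩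
    · obtain ⟨h3, h4, h5⟩ := List.replicate_eq_append_iff.1 h1
      refine ⟨[(p.1, w1.length)], (p.1, t.length) :: l, ?_, ?_, by simp; omega⟩
      · rw [flat_cons]; simp only [← h4]; simp [flat]
      · rw [flat_cons, h2]; simp only [← h5]

/-- weight of a word -/
def psi {n : ℕ} (om : Fin n → ℤ) (w : List (Fin n)) : ℤ := (w.map om).sum

/-- suffix weights -/
def SV {n : ℕ} (om : Fin n → ℤ) (w : List (Fin n)) : Set ℤ := {v | ∃ t, t <:+ w ∧ psi om t = v}

lemma SV_finite {n : ℕ} (om : Fin n → ℤ) (w : List (Fin n)) : (SV om w).Finite := by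
  have : SV om w = psi om '' {t | t ∈ w.tails} := by
    ext v; simp [SV]
  rw [this]
  exact (List.finite_toSet _).image _

lemma SV_append {n : ℕ} (om : Fin n → ℤ) (u w : List (Fin n)) : SV om w ⊆ SV om (u ++ w) := by
  rintro v ⟨t, ht, rfl⟩
  exact ⟨t, ht.trans (List.suffix_append _ _), rfl⟩

lemma psi_append {n : ℕ} (om : Fin n → ℤ) (u w : List (Fin n)) :
    psi om (u ++ w) = psi om u + psi om w := by simp [psi]

lemma SV_dense {n : ℕ} (om : Fin n → ℤ) (b : ℕ) (hb : 1 ≤ b) (hom : ∀ j, |om j| ≤ b)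
    (w : List (Fin n)) :
    ∀ p ∈ SV om w, ∀ q ∈ SV om w, ∀ r, p ≤ r → r ≤ q → ∃ v ∈ SV om w, r - b < v ∧ v ≤ r := by
  induction w with
  | nil =>
    rintro p ⟨t, ht, rfl⟩ q ⟨t', ht', rfl⟩ r h1 h2
    rw [List.suffix_nil] at ht ht'
    subst ht ht'
    exact ⟨_, ⟨[], by simp, rfl⟩, by omega, h1⟩
  | cons a w ih =>
    have hsub : SV om w ⊆ SV om (a :: w) := SV_append om [a] w
    have hw : psi om w ∈ SV om w := ⟨w, List.suffix_refl _, rfl⟩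
    have haw : psi om (a :: w) ∈ SV om (a :: w) := ⟨_, List.suffix_refl _, rfl⟩
    have hcase : ∀ v ∈ SV om (a :: w), v = psi om (a :: w) ∨ v ∈ SV om w := by
      rintro v ⟨t, ht, rfl⟩
      rcases List.suffix_cons_iff.1 ht with rfl | h
      · exact Or.inl rfl
      · exact Or.inr ⟨t, h, rfl⟩
    have hstep : psi om (a :: w) = om a + psi om w := by simp [psi]
    have habs := abs_le.1 (hom a)
    intro p hp q hq r h1 h2
    rcases hcase p hp with rfl | hp' <;> rcases hcase q hq with rfl | hq'
    · exact ⟨_, haw, by omega, h1⟩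
    · by_cases h : psi om w ≤ r
      · obtain ⟨v, hv, h3⟩ := ih _ hw _ hq' r h h2
        exact ⟨v, hsub hv, h3⟩
      · exact ⟨_, haw, by omega, h1⟩
    · by_cases h : r ≤ psi om w
      · obtain ⟨v, hv, h3⟩ := ih _ hp' _ hw r h1 h
        exact ⟨v, hsub hv, h3⟩
      · by_cases h' : r = psi om (a :: w)
        · exact ⟨_, haw, by omega, by omega⟩
        · exact ⟨_, hsub hw, by omega, by omega⟩
    · obtain ⟨v, hv, h3⟩ := ih _ hp' _ hq' r h1 h2
      exact ⟨v, hsub hv, h3⟩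

section grp
variable {G : Type*} [Group G] {n : ℕ}

lemma push (x : Fin n → G) (z : G) (hz : ∀ g, g * z = z * g) (i : Fin n) (om : Fin n → ℤ)
    (hom : ∀ j, x i * x j = x j * x i * z ^ om j) (w : List (Fin n)) (c : ℕ) :
    x i ^ c * (w.map x).prod = (w.map x).prod * x i ^ c * z ^ ((c : ℤ) * psi om w) := by
  have hzz : ∀ (k : ℤ) (g : G), z ^ k * g = g * z ^ k := fun k g =>
    ((show Commute g z from hz g).zpow_right k).eq.symm
  have h1 : ∀ w : List (Fin n), x i * (w.map x).prod = (w.map x).prod * x i * z ^ psi om w := by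
    intro w
    induction w with
    | nil => simp [psi]
    | cons a w ih =>
      have : psi om (a :: w) = psi om w + om a := by simp [psi, add_comm]
      rw [List.map_cons, List.prod_cons, ← mul_assoc, hom, mul_assoc, hzz, ← mul_assoc,
        mul_assoc (x a), ih, this, zpow_add]
      simp only [mul_assoc]
  induction c with
  | zero => simp
  | succ c ih =>
    rw [pow_succ', mul_assoc, ih, ← mul_assoc, ← mul_assoc, h1]
    have : (((c + 1 : ℕ) : ℤ)) * psi om w = psi om w + c * psi om w := by push_cast; ring
    rw [this, zpow_add, mul_assoc _ (z ^ _) (x i ^ c), hzz]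
    simp only [mul_assoc]

lemma decomp (x : Fin n → G) (z : G) (hz : ∀ g, g * z = z * g) (i : Fin n) (om : Fin n → ℤ)
    (hom : ∀ j, x i * x j = x j * x i * z ^ om j) (l : List (Fin n × ℕ))
    (hpos : ∀ p ∈ l, p.2 ≠ 0) :
    ∃ F : List ℤ, (∀ v ∈ F, v ∈ SV om (flat (l.filter (fun p => p.1 ≠ i)))) ∧
      (l.filter (fun p => p.1 = i)).length ≤ F.length ∧
      ((flat l).map x).prod = ((flat (l.filter (fun p => p.1 ≠ i))).map x).prod *
        x i ^ F.length * z ^ F.sum := by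
  induction l with
  | nil => exact ⟨[], by simp, by simp, by simp [flat]⟩
  | cons p l ih =>
    obtain ⟨F, h1, h2, h3⟩ := ih fun q hq => hpos q (by simp [hq])
    have hp := hpos p (by simp)
    obtain ⟨j, e⟩ := p
    by_cases hj : j = i
    · subst hj
      set W := flat (l.filter (fun p => p.1 ≠ j)) with hW
      refine ⟨List.replicate e (psi om W) ++ F, ?_, ?_, ?_⟩
      · rw [List.filter_cons_of_neg (by simp), ← hW]
        intro v hv
        rcases List.mem_append.1 hv with hv | hv
        · rw [List.eq_of_mem_replicate hv]
          exact ⟨W, List.suffix_refl _, rfl⟩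
        · exact h1 v hv
      · rw [List.filter_cons_of_pos (by simp)]
        simp at hp h2 ⊢
        omega
      · rw [List.filter_cons_of_neg (by simp), ← hW, flat_cons, List.map_append, List.prod_append,
          h3]
        simp only [List.map_replicate, List.prod_replicate, List.length_append,
          List.length_replicate, List.sum_append, List.sum_replicate, nsmul_eq_mul]
        rw [zpow_add, pow_add, ← mul_assoc, ← mul_assoc, push x z hz j om hom]
        have hzz : ∀ (k : ℤ) (g : G), z ^ k * g = g * z ^ k := fun k g =>
          ((show Commute g z from hz g).zpow_right k).eq.symm
        rw [mul_assoc _ (z ^ _) (x j ^ _), hzz]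
        simp only [mul_assoc]
    · refine ⟨F, ?_, ?_, ?_⟩
      · rw [List.filter_cons_of_pos (by simpa using hj), flat_cons]
        exact fun v hv => SV_append _ _ _ (h1 v hv)
      · rw [List.filter_cons_of_neg (by simpa using hj)]
        exact h2
      · rw [List.filter_cons_of_pos (by simpa using hj), flat_cons, flat_cons, List.map_append,
          List.prod_append, h3, List.map_append, List.prod_append]
        simp only [mul_assoc]

lemma insertAll (x : Fin n → G) (z : G) (hz : ∀ g, g * z = z * g) (i : Fin n) (om : Fin n → ℤ)
    (hom : ∀ j, x i * x j = x j * x i * z ^ om j) (hi : om i = 0) (cs : List (ℤ × ℕ)) :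
    ∀ l : List (Fin n × ℕ), (∀ p ∈ cs, p.1 ∈ SV om (flat l)) →
    ∃ l' : List (Fin n × ℕ), l'.length ≤ l.length + 2 * cs.length ∧
      ((flat l').map x).prod = ((flat l).map x).prod * x i ^ (cs.map (·.2)).sum *
        z ^ (cs.map (fun p => (p.2 : ℤ) * p.1)).sum := by
  have hzz : ∀ (k : ℤ) (g : G), z ^ k * g = g * z ^ k := fun k g =>
    ((show Commute g z from hz g).zpow_right k).eq.symm
  induction cs with
  | nil => intro l _; exact ⟨l, by simp, by simp⟩
  | cons p cs ih =>
    intro l hl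
    obtain ⟨v, c⟩ := p
    obtain ⟨t, ⟨u, hut⟩, hv⟩ := hl (v, c) (by simp)
    simp only at hv
    obtain ⟨l1, l2, rfl, rfl, hlen⟩ := flat_split l u t hut.symm
    have hrep : psi om (List.replicate c i) = 0 := by simp [psi, hi]
    have hsv : SV om (flat l) ⊆ SV om (flat (l1 ++ (i, c) :: l2)) := by
      rintro y ⟨t', ht', rfl⟩
      rw [← hut] at ht'
      rw [flat_append, flat_cons]
      obtain ⟨s, hs⟩ := ht'
      rcases List.append_eq_append_iff.1 hs with ⟨a, h1, h2⟩ | ⟨a, h1, h2⟩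
      · refine ⟨a ++ (List.replicate c i ++ flat l2), ⟨s, by rw [h1]; simp⟩, ?_⟩
        rw [h2]
        simp only [psi_append, hrep, zero_add]
      · refine ⟨t', ⟨flat l1 ++ List.replicate c i ++ a, by rw [h2]; simp⟩, rfl⟩
    obtain ⟨l', h1, h2⟩ := ih (l1 ++ (i, c) :: l2)
      fun p hp => hsv (hl p (by simp [hp]))
    refine ⟨l', by simp at h1 ⊢; omega, ?_⟩
    rw [h2, ← hut, flat_append, flat_cons]
    simp only [List.map_append, List.prod_append, List.map_replicate, List.prod_replicate,
      List.map_cons, List.sum_cons]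
    rw [push x z hz i om hom, hv, zpow_add, pow_add]
    simp only [mul_assoc]
    rw [← mul_assoc (z ^ _) (x i ^ _), hzz]
    simp only [mul_assoc]

lemma reduce (x : Fin n → G) (z : G) (hz : ∀ g, g * z = z * g) (b : ℕ) (hb : 1 ≤ b)
    (hbnd : ∀ i j, ∃ k : ℤ, |k| ≤ (b : ℤ) ∧ commE (x i) (x j) = z ^ k)
    (l : List (Fin n × ℕ)) (hpos : ∀ p ∈ l, p.2 ≠ 0) (i : Fin n)
    (hK : 4 * (b ^ 2 + 1) < (l.filter (fun p => p.1 = i)).length) :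
    ∃ l' : List (Fin n × ℕ), l'.length < l.length ∧
      ((flat l').map x).prod = ((flat l).map x).prod := by
  choose k hk1 hk2 using fun j => hbnd i j
  set om : Fin n → ℤ := fun j => if j = i then 0 else k j with hom_def
  have hi : om i = 0 := by simp [om]
  have hom : ∀ j, x i * x j = x j * x i * z ^ om j := by
    intro j
    by_cases hj : j = i
    · subst hj; simp [hi]
    · simp only [om, hj, if_false]
      rw [← hk2 j, commE]; group
  have hob : ∀ j, |om j| ≤ b := by
    intro j
    by_cases hj : j = i
    · subst hj; simp [hi]
    · simpa only [om, hj, if_false] using hk1 j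
  obtain ⟨F, h1, h2, h3⟩ := decomp x z hz i om hom l hpos
  obtain ⟨cs, c1, c2, c3, c4⟩ := core b _ (SV_finite om _) hb (SV_dense om b hb hob _) F h1
    (by nlinarith)
  obtain ⟨l', e1, e2⟩ := insertAll x z hz i om hom hi cs _ c2
  refine ⟨l', ?_, by rw [e2, c3, c4, h3]⟩
  have hl := List.length_eq_length_filter_add (l := l) (fun p => decide (p.1 = i))
  have hf : (l.filter (fun p => p.1 ≠ i)) = l.filter (fun p => !decide (p.1 = i)) := by
    congr 1; ext p; simp
  rw [hf] at e1
  have : 2 * (b + 3) < 4 * (b ^ 2 + 1) + 1 := by nlinarith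
  omega

lemma exists_short (x : Fin n → G) (z : G) (hz : ∀ g, g * z = z * g) (b : ℕ) (hb : 1 ≤ b)
    (hbnd : ∀ i j, ∃ k : ℤ, |k| ≤ (b : ℤ) ∧ commE (x i) (x j) = z ^ k) (N : ℕ) :
    ∀ l : List (Fin n × ℕ), l.length ≤ N →
    ∃ l' : List (Fin n × ℕ), l'.length ≤ 4 * n * (b ^ 2 + 1) ∧
      ((flat l').map x).prod = ((flat l).map x).prod := by
  induction N with
  | zero => intro l hl; exact ⟨l, by omega, rfl⟩
  | succ N ih =>
    intro l hl
    by_cases hpos : ∀ p ∈ l, p.2 ≠ 0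
    · by_cases hlen : l.length ≤ 4 * n * (b ^ 2 + 1)
      · exact ⟨l, hlen, rfl⟩
      obtain ⟨i, hi⟩ : ∃ i : Fin n, 4 * (b ^ 2 + 1) < (l.filter (fun p => p.1 = i)).length := by
        by_contra! hcon
        apply hlen
        have hs : ∀ l : List (Fin n × ℕ),
            l.length = ∑ i : Fin n, (l.filter (fun p => p.1 = i)).length := by
          intro l
          induction l with
          | nil => simp
          | cons p l ih =>
            have : ∀ i : Fin n, ((p :: l).filter (fun p => p.1 = i)).length =
                (if p.1 = i then 1 else 0) + (l.filter (fun p => p.1 = i)).length := by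
              intro i
              by_cases h : p.1 = i
              · simp [h, add_comm]
              · simp [h]
            simp only [this, Finset.sum_add_distrib, ← ih]
            simp [add_comm]
        rw [hs l]
        calc _ ≤ ∑ i : Fin n, 4 * (b ^ 2 + 1) := Finset.sum_le_sum fun i _ => hcon i
          _ = _ := by simp; ring
      obtain ⟨l', h1, h2⟩ := reduce x z hz b hb hbnd l hpos i hi
      obtain ⟨l'', h3, h4⟩ := ih l' (by omega)
      exact ⟨l'', h3, h4.trans h2⟩
    · push Not at hpos
      obtain ⟨p, hp, hp0⟩ := hpos
      obtain ⟨s, t, rfl⟩ := List.append_of_mem hp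
      obtain ⟨l'', h3, h4⟩ := ih (s ++ t) (by simp at hl ⊢; omega)
      refine ⟨l'', h3, h4.trans ?_⟩
      rw [flat_append, flat_append, flat_cons, hp0]
      simp

end grp

end Stmt9

theorem stmt_9 (G : Type*) [Group G] [Group.FG G] (z : G)
    (hzc : Subgroup.zpowers z = commutator G)
    (hzcen : (commutator G : Set G) ⊆ Subgroup.center G)
    (hzinf : ¬ IsOfFinOrder z)
    (n : ℕ) (x : Fin n → G) (b : ℕ) (hb : 1 ≤ b)
    (hbnd : ∀ i j, ∃ k : ℤ, |k| ≤ (b : ℤ) ∧ commE (x i) (x j) = z ^ k) :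
    (Submonoid.closure (Set.range x) : Set G) =
      foldProd (4 * n * (b ^ 2 + 1)) (⋃ i, {g : G | ∃ e : ℕ, g = x i ^ e}) := by
  classical
  have hz : ∀ g, g * z = z * g := by
    have h1 : z ∈ commutator G := hzc ▸ Subgroup.mem_zpowers z
    exact fun g => Subgroup.mem_center_iff.1 (hzcen h1) g
  apply Set.Subset.antisymm
  · intro g hg
    obtain ⟨l, hl⟩ : ∃ l : List (Fin n × ℕ), ((Stmt9.flat l).map x).prod = g := by
      refine Submonoid.closure_induction (motive := fun g _ => ∃ l : List (Fin n × ℕ),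
        ((Stmt9.flat l).map x).prod = g) ?_ ?_ ?_ hg
      · rintro _ ⟨i, rfl⟩
        exact ⟨[(i, 1)], by simp [Stmt9.flat]⟩
      · exact ⟨[], by simp [Stmt9.flat]⟩
      · rintro _ _ _ _ ⟨l, rfl⟩ ⟨l', rfl⟩
        exact ⟨l ++ l', by simp [Stmt9.flat_append]⟩
    obtain ⟨l', h1, h2⟩ := Stmt9.exists_short x z hz b hb hbnd _ l le_rfl
    rw [hl] at h2
    have hprod : ∀ l : List (Fin n × ℕ),
        (l.map (fun p => x p.1 ^ p.2)).prod = ((Stmt9.flat l).map x).prod := by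
      intro l
      induction l with
      | nil => simp [Stmt9.flat]
      | cons p l ih => rw [Stmt9.flat_cons]; simp [ih]
    obtain ⟨r, hr⟩ := Nat.exists_eq_add_of_le h1
    have key : ∀ (L : List G) (N : ℕ), N = L.length →
        (∀ g ∈ L, g ∈ (⋃ i, {g : G | ∃ e : ℕ, g = x i ^ e})) →
        L.prod ∈ foldProd N (⋃ i, {g : G | ∃ e : ℕ, g = x i ^ e}) := by
      rintro L N rfl hL
      exact ⟨L.get, fun i => hL _ (List.get_mem _ _), by rw [List.ofFn_get]⟩
    have hfin : (l'.map (fun p : Fin n × ℕ => x p.1 ^ p.2) ++ List.replicate r 1).prod = g := by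
      rw [List.prod_append, hprod, h2]; simp
    rw [← hfin]
    apply key
    · simp [hr]
    · intro g hg
      rcases List.mem_append.1 hg with hg | hg'
      · obtain ⟨p, _, rfl⟩ := List.mem_map.1 hg
        exact Set.mem_iUnion.2 ⟨p.1, p.2, rfl⟩
      · have hg1 := List.eq_of_mem_replicate hg'
        rcases n with _ | n
        · have : r = 0 := by simp at hr; omega
          subst this
          simp at hg'
        · exact Set.mem_iUnion.2 ⟨0, 0, by simp [hg1]⟩
  · rintro _ ⟨s, hs, rfl⟩
    apply Submonoid.list_prod_mem
    intro g hg
    obtain ⟨k, rfl⟩ := (List.mem_ofFn' _ _).1 hg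
    obtain ⟨i, e, he⟩ := Set.mem_iUnion.1 (hs k)
    rw [he]
    exact Submonoid.pow_mem _ (Submonoid.subset_closure (Set.mem_range_self i)) e
end

section
/- In the discrete Heisenberg group $H_3(\mathbb{Z})$ (generated by $x, y$ with $z = [x,y]$ central), every finitely generated submonoid is boundedly generated: if $M$ is generated by $g_1, \dots, g_n$, then there exist $h_1, \dots, h_N \in \{g_1,\dots,g_n\}$ (with repetitions allowed) such that $M = h_1^* h_2^* \cdots h_N^*$. -/
/-- The discrete Heisenberg group `H₃(ℤ)`, as triples `(a, b, c)` recording the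
entries of an upper unitriangular `3 × 3` integer matrix
`![![1, a, c], ![0, 1, b], ![0, 0, 1]]`. -/
@[ext]
structure H3 where
  a : ℤ
  b : ℤ
  c : ℤ

instance : Mul H3 := ⟨fun p q => ⟨p.a + q.a, p.b + q.b, p.c + q.c + p.a * q.b⟩⟩
instance : One H3 := ⟨⟨0, 0, 0⟩⟩
instance : Inv H3 := ⟨fun p => ⟨-p.a, -p.b, -p.c + p.a * p.b⟩⟩

@[simp] lemma H3.mul_a (p q : H3) : (p * q).a = p.a + q.a := rfl
@[simp] lemma H3.mul_b (p q : H3) : (p * q).b = p.b + q.b := rfl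
@[simp] lemma H3.mul_c (p q : H3) : (p * q).c = p.c + q.c + p.a * q.b := rfl
@[simp] lemma H3.one_a : (1 : H3).a = 0 := rfl
@[simp] lemma H3.one_b : (1 : H3).b = 0 := rfl
@[simp] lemma H3.one_c : (1 : H3).c = 0 := rfl
@[simp] lemma H3.inv_a (p : H3) : p⁻¹.a = -p.a := rfl
@[simp] lemma H3.inv_b (p : H3) : p⁻¹.b = -p.b := rfl
@[simp] lemma H3.inv_c (p : H3) : p⁻¹.c = -p.c + p.a * p.b := rfl

instance : Group H3 where
  mul_assoc p q r := by ext <;> simp <;> ring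
  one_mul p := by ext <;> simp
  mul_one p := by ext <;> simp
  inv_mul_cancel p := by ext <;> simp


namespace H3P
open scoped Pointwise

/-- determinant of the abelianised parts -/
def dt (x y : H3) : ℤ := x.a * y.b - y.a * x.b
/-- central elements -/
def Z (k : ℤ) : H3 := ⟨0, 0, k⟩

@[simp] lemma Z_a (k : ℤ) : (Z k).a = 0 := rfl
@[simp] lemma Z_b (k : ℤ) : (Z k).b = 0 := rfl
@[simp] lemma Z_c (k : ℤ) : (Z k).c = k := rfl

lemma swap (x y : H3) : x * y = y * x * Z (dt x y) := by
  ext <;> simp [dt] <;> ring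
lemma Z_comm (k : ℤ) (x : H3) : Z k * x = x * Z k := by
  ext <;> simp <;> ring
lemma Z_add (j k : ℤ) : Z j * Z k = Z (j + k) := by
  ext <;> simp
lemma Z_zero : Z 0 = 1 := by
  ext <;> simp
lemma Z_pow (j : ℤ) (k : ℕ) : Z j ^ k = Z (k * j) := by
  induction k with
  | zero => simp [Z_zero]
  | succ k ih => rw [pow_succ, ih, Z_add]; congr 1; push_cast; ring
lemma eq_mul_Z {x y : H3} (ha : x.a = y.a) (hb : x.b = y.b) : x = y * Z (x.c - y.c) := by
  ext <;> simp [ha, hb]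
lemma pow_a (x : H3) (k : ℕ) : (x ^ k).a = k * x.a := by
  induction k with
  | zero => simp
  | succ k ih => rw [pow_succ, H3.mul_a, ih]; push_cast; ring
lemma pow_b (x : H3) (k : ℕ) : (x ^ k).b = k * x.b := by
  induction k with
  | zero => simp
  | succ k ih => rw [pow_succ, H3.mul_b, ih]; push_cast; ring
/-- symmetric coordinate -/
def sc (x : H3) : ℤ := 2 * x.c - x.a * x.b
lemma sc_mul (x y : H3) : sc (x * y) = sc x + sc y + dt x y := by
  simp [sc, dt]; ring
lemma sc_pow (x : H3) (k : ℕ) : sc (x ^ k) = k * sc x := by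
  induction k with
  | zero => simp [sc]
  | succ k ih =>
    rw [pow_succ, sc_mul, ih]; simp [dt, pow_a, pow_b]; ring

variable {n : ℕ}

/-- product of cyclic monoids -/
def pat (g : Fin n → H3) (L : List (Fin n)) : Set H3 :=
  (L.map fun i => Set.range fun k : ℕ => g i ^ k).prod

lemma pat_append (g : Fin n → H3) (L L' : List (Fin n)) :
    pat g (L ++ L') = pat g L * pat g L' := by simp [pat]
lemma pat_cons (g : Fin n → H3) (i : Fin n) (L : List (Fin n)) :
    pat g (i :: L) = (Set.range fun k : ℕ => g i ^ k) * pat g L := by simp [pat]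
lemma pat_nil (g : Fin n → H3) : pat g [] = {1} := by simp [pat, Set.singleton_one]
lemma one_mem_pat (g : Fin n → H3) (L : List (Fin n)) : (1 : H3) ∈ pat g L := by
  induction L with
  | nil => simp [pat_nil]
  | cons i L ih =>
    rw [pat_cons]; exact ⟨1, ⟨0, by simp⟩, 1, ih, by simp⟩

def Bd (g : Fin n → H3) (S : Set H3) : Prop := ∃ L, S ⊆ pat g L

lemma Bd.mono {g : Fin n → H3} {S T : Set H3} (h : Bd g T) (hs : S ⊆ T) : Bd g S := by
  obtain ⟨L, hL⟩ := h; exact ⟨L, hs.trans hL⟩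
lemma Bd.mul {g : Fin n → H3} {S T : Set H3} (h : Bd g S) (h' : Bd g T) : Bd g (S * T) := by
  obtain ⟨L, hL⟩ := h; obtain ⟨L', hL'⟩ := h'
  exact ⟨L ++ L', by rw [pat_append]; exact Set.mul_subset_mul hL hL'⟩
lemma Bd.union {g : Fin n → H3} {S T : Set H3} (h : Bd g S) (h' : Bd g T) : Bd g (S ∪ T) := by
  obtain ⟨L, hL⟩ := h; obtain ⟨L', hL'⟩ := h'
  refine ⟨L ++ L', ?_⟩
  rw [pat_append]
  rintro x (hx | hx)
  · exact ⟨x, hL hx, 1, one_mem_pat _ _, by simp⟩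
  · exact ⟨1, one_mem_pat _ _, x, hL' hx, by simp⟩
lemma Bd.pows (g : Fin n → H3) (i : Fin n) : Bd g (Set.range fun k : ℕ => g i ^ k) :=
  ⟨[i], by rw [pat_cons, pat_nil]; simp⟩
lemma Bd.one (g : Fin n → H3) : Bd g {1} := ⟨[], by simp [pat_nil]⟩
lemma Bd.single {g : Fin n → H3} {x : H3} (hx : x ∈ Submonoid.closure (Set.range g)) :
    Bd g {x} := by
  induction hx using Submonoid.closure_induction with
  | mem x hx =>
    obtain ⟨i, rfl⟩ := hx
    exact (Bd.pows g i).mono (by rintro _ rfl; exact ⟨1, by simp⟩)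
  | one => exact Bd.one g
  | mul x y _ _ hx hy => exact (hx.mul hy).mono (by simp)
lemma Bd.finite {g : Fin n → H3} {S : Set H3} (hS : S.Finite)
    (h : S ⊆ Submonoid.closure (Set.range g)) : Bd g S := by
  induction S, hS using Set.Finite.induction_on with
  | empty => exact ⟨[], by simp⟩
  | insert _ _ ih =>
    rw [Set.insert_eq]
    refine Bd.union (Bd.single (h (by simp))) (ih fun x hx => h (by simp [hx]))

lemma pat_le (g : Fin n → H3) (L : List (Fin n)) :
    pat g L ⊆ Submonoid.closure (Set.range g) := by
  induction L with
  | nil => simp [pat_nil]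
  | cons i L ih =>
    rw [pat_cons]
    rintro _ ⟨_, ⟨k, rfl⟩, y, hy, rfl⟩
    exact Submonoid.mul_mem _ (Submonoid.pow_mem _ (Submonoid.subset_closure (Set.mem_range_self i)) k) (ih hy)

lemma mem_pat_iff (g : Fin n → H3) (L : List (Fin n)) (t : H3) :
    t ∈ pat g L ↔ ∃ s : Fin L.length → ℕ, (List.ofFn fun j => g (L.get j) ^ s j).prod = t := by
  induction L generalizing t with
  | nil => simp [pat_nil, eq_comm]
  | cons i L ih =>
    rw [pat_cons]
    constructor
    · rintro ⟨_, ⟨k, rfl⟩, y, hy, rfl⟩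
      obtain ⟨s, hs⟩ := (ih y).1 hy
      refine ⟨Fin.cons k s, ?_⟩
      rw [← hs]
      simp [List.ofFn_succ]
    · rintro ⟨s, rfl⟩
      refine ⟨g i ^ s 0, ⟨_, rfl⟩, _, (ih _).2 ⟨fun j => s j.succ, rfl⟩, ?_⟩
      simp [List.ofFn_succ]

theorem final_of_Bd (g : Fin n → H3) (h : Bd g (Submonoid.closure (Set.range g))) :
    ∃ (N : ℕ) (h : Fin N → H3),
      (∀ j, ∃ i, h j = g i) ∧
      (Submonoid.closure (Set.range g) : Set H3) =
        {t : H3 | ∃ s : Fin N → ℕ, (List.ofFn fun j => h j ^ s j).prod = t} := by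
  obtain ⟨L, hL⟩ := h
  refine ⟨L.length, fun j => g (L.get j), fun j => ⟨_, rfl⟩, ?_⟩
  ext t
  rw [Set.mem_ofPred_eq, ← mem_pat_iff]
  exact ⟨fun h => hL h, fun h => pat_le g L h⟩

lemma pat_perm (g : Fin n → H3) (σ : Equiv.Perm (Fin n)) (L : List (Fin n)) :
    pat (g ∘ σ) L = pat g (L.map σ) := by
  simp [pat, Function.comp_def]

lemma Bd_perm (g : Fin n → H3) (σ : Equiv.Perm (Fin n))
    (h : Bd (g ∘ σ) (Submonoid.closure (Set.range (g ∘ σ)))) :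
    Bd g (Submonoid.closure (Set.range g)) := by
  obtain ⟨L, hL⟩ := h
  rw [pat_perm] at hL
  refine ⟨L.map σ, ?_⟩
  rwa [EquivLike.range_comp] at hL

/-! ### words -/

def val (g : Fin n → H3) (w : List (Fin n)) : H3 := (w.map g).prod

lemma val_append (g : Fin n → H3) (u v : List (Fin n)) : val g (u ++ v) = val g u * val g v := by
  simp [val]
lemma val_cons (g : Fin n → H3) (i : Fin n) (v : List (Fin n)) :
    val g (i :: v) = g i * val g v := by
  simp [val]
lemma val_nil (g : Fin n → H3) : val g [] = 1 := by simp [val]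

lemma exists_word (g : Fin n → H3) {t : H3} (ht : t ∈ Submonoid.closure (Set.range g)) :
    ∃ w, val g w = t := by
  induction ht using Submonoid.closure_induction with
  | mem x hx => obtain ⟨i, rfl⟩ := hx; exact ⟨[i], by simp [val]⟩
  | one => exact ⟨[], by simp [val]⟩
  | mul x y _ _ hx hy =>
    obtain ⟨u, rfl⟩ := hx; obtain ⟨v, rfl⟩ := hy
    exact ⟨u ++ v, val_append g u v⟩

def code : List (Fin n) → ℕ
  | [] => 0
  | a :: l => a * n ^ l.length + code l

lemma code_lt (l : List (Fin n)) : code l < n ^ l.length := by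
  induction l with
  | nil => simp [code]
  | cons a l ih =>
    simp only [code, List.length_cons, pow_succ]
    have : (a : ℕ) + 1 ≤ n := a.2
    nlinarith [Nat.mul_le_mul_right (n ^ l.length) this]

lemma code_append (u v : List (Fin n)) : code (u ++ v) = code u * n ^ v.length + code v := by
  induction u with
  | nil => simp [code]
  | cons a u ih => simp only [List.cons_append, code, ih, List.length_append, pow_add]; ring

lemma code_append_lt {u u' v v' : List (Fin n)} (hv : v'.length = v.length)
    (h : code u' < code u) : code (u' ++ v') < code (u ++ v) := by
  rw [code_append, code_append, hv]
  have h1 := code_lt v'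
  rw [hv] at h1
  have := Nat.mul_le_mul_right (n ^ v.length) (Nat.succ_le_of_lt h)
  rw [Nat.succ_mul] at this
  omega

lemma code_append_le {u u' v v' : List (Fin n)} (hv : v'.length = v.length)
    (h : code u' ≤ code u) (h' : code v' ≤ code v) : code (u' ++ v') ≤ code (u ++ v) := by
  rw [code_append, code_append, hv]
  exact add_le_add (Nat.mul_le_mul_right _ h) h'

def Mn (g : Fin n → H3) (c : List (Fin n)) : Prop :=
  ∀ c' : List (Fin n), c'.length = c.length → val g c' = val g c → code c ≤ code c'

lemma Mn.infix {g : Fin n → H3} {a b c : List (Fin n)} (h : Mn g (a ++ (b ++ c))) : Mn g b := by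
  intro b' hl hv
  by_contra hlt
  push Not at hlt
  have := h (a ++ (b' ++ c)) (by simp [hl]) (by simp [val_append, hv])
  have h2 := code_append_lt (v := c) (v' := c) rfl hlt
  rw [code_append a, code_append a] at this
  simp only [List.length_append, hl] at this
  omega
lemma Mn.left {g : Fin n → H3} {a b : List (Fin n)} (h : Mn g (a ++ b)) : Mn g a :=
  Mn.infix (a := []) (c := b) (by simpa using h)
lemma Mn.right {g : Fin n → H3} {a b : List (Fin n)} (h : Mn g (a ++ b)) : Mn g b :=
  Mn.infix (a := a) (c := []) (by simpa using h)

lemma exists_Mn (g : Fin n → H3) (w : List (Fin n)) :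
    ∃ w', Mn g w' ∧ val g w' = val g w := by
  obtain ⟨w', ⟨h1, h2⟩, h3⟩ := (InvImage.wf code Nat.lt_wfRel.wf).has_min
    {w' : List (Fin n) | w'.length = w.length ∧ val g w' = val g w} ⟨w, rfl, rfl⟩
  refine ⟨w', fun c hl hv => ?_, h2⟩
  have := h3 c ⟨hl.trans h1, hv.trans h2⟩
  exact not_lt.1 this

/-! ### concatenations of sorted lists -/

def Srt : ℕ → List (Fin n) → Prop
  | 0, w => w = []
  | k + 1, w => ∃ u v, w = u ++ v ∧ u.Pairwise (· ≤ ·) ∧ Srt k v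

lemma Srt_nil (k : ℕ) : Srt (n := n) k [] := by
  induction k with
  | zero => rfl
  | succ k ih => exact ⟨[], [], rfl, List.Pairwise.nil, ih⟩
lemma Srt.add {j k : ℕ} {u v : List (Fin n)} (hu : Srt j u) (hv : Srt k v) :
    Srt (j + k) (u ++ v) := by
  induction j generalizing u with
  | zero => cases hu; simpa using hv
  | succ j ih =>
    obtain ⟨a, b, rfl, ha, hb⟩ := hu
    rw [Nat.add_right_comm]
    exact ⟨a, b ++ v, by simp, ha, ih hb⟩
lemma Srt.of_sorted {u : List (Fin n)} (hu : u.Pairwise (· ≤ ·)) : Srt 1 u :=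
  ⟨u, [], by simp, hu, rfl⟩
lemma Srt.mono {j k : ℕ} (hjk : j ≤ k) {u : List (Fin n)} (hu : Srt j u) : Srt k u := by
  obtain ⟨m, rfl⟩ := Nat.exists_eq_add_of_le hjk
  simpa using hu.add (Srt_nil m)

/-- If `w` is long, a long prefix can be split off. -/
lemma split (j k : ℕ) (w : List (Fin n)) (h : ¬ Srt (j + 1 + k) w) :
    ∃ u v, w = u ++ v ∧ ¬ Srt j u ∧ ¬ Srt k v := by
  by_contra hcon
  push Not at hcon
  -- every prefix is `Srt j`
  have key : ∀ v u : List (Fin n), w = u ++ v → Srt j u → Srt (j + 1 + k) w := by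
    intro v
    induction v with
    | nil => 
      intro u hw hu
      rw [hw, List.append_nil]
      exact hu.mono (by omega)
    | cons x v ih =>
      intro u hw hu
      have hw' : w = (u ++ [x]) ++ v := by simp [hw]
      by_cases hx : Srt j (u ++ [x])
      · exact ih _ hw' hx
      · have hv := hcon _ _ hw' hx
        rw [hw']
        exact (hu.add (Srt.of_sorted (u := [x]) (by simp))).add hv
  exact h (key w [] rfl (Srt_nil j))

lemma sorted_pat (g : Fin n → H3) {s : List (Fin n)} (hs : s.Pairwise (· ≤ ·)) :
    val g s ∈ pat g (List.finRange n) := by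
  have gen : ∀ L : List (Fin n), L.Pairwise (· < ·) → ∀ s : List (Fin n), s.Pairwise (· ≤ ·) →
      (∀ x ∈ s, x ∈ L) → val g s ∈ pat g L := by
    intro L
    induction L with
    | nil => 
      intro _ s _ h
      have : s = [] := List.eq_nil_iff_forall_not_mem.2 fun x hx => by simpa using h x hx
      simp [this, val_nil, pat_nil]
    | cons i L ih =>
      intro hL s
      rw [List.pairwise_cons] at hL
      induction s with
      | nil => intro _ _; rw [val_nil]; exact one_mem_pat _ _
      | cons x s ihs =>
        intro hs hm
        rw [List.pairwise_cons] at hs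
        by_cases hx : x = i
        · subst hx
          have := ihs hs.2 fun y hy => hm y (by simp [hy])
          rw [pat_cons] at this ⊢
          obtain ⟨_, ⟨k, rfl⟩, y, hy, hk⟩ := this
          refine ⟨_, ⟨k + 1, rfl⟩, y, hy, ?_⟩
          rw [val_cons, ← hk]
          simp only [pow_succ', mul_assoc]
        · have hxL : x ∈ L := by
            have := hm x (by simp)
            simpa [hx] using this
          have := ih hL.2 (x :: s) (List.pairwise_cons.2 hs) (by
            intro y hy
            have hy' := hm y hy
            rcases List.mem_cons.1 hy' with rfl | h
            · exfalso
              rcases List.mem_cons.1 hy with h | h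
              · exact hx h.symm
              · exact absurd (hs.1 _ h) (not_le.2 (hL.1 x hxL))
            · exact h)
          rw [pat_cons]
          exact ⟨1, ⟨0, by simp⟩, _, this, by simp⟩
  exact gen _ (List.pairwise_lt_finRange n) s hs (by simp)

lemma Srt_pat (g : Fin n → H3) (k : ℕ) :
    ∃ L, ∀ w, Srt k w → val g w ∈ pat g L := by
  induction k with
  | zero => exact ⟨[], by rintro w rfl; simp [val_nil, pat_nil]⟩
  | succ k ih =>
    obtain ⟨L, hL⟩ := ih
    refine ⟨List.finRange n ++ L, ?_⟩
    rintro w ⟨u, v, rfl, hu, hv⟩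
    rw [pat_append, val_append]
    exact ⟨_, sorted_pat g hu, _, hL v hv, rfl⟩


/-! ### moves -/

def Down (g : Fin n → H3) (d : ℕ) (c : List (Fin n)) : Prop :=
  ∃ c' : List (Fin n), c'.length = c.length ∧ code c' ≤ code c ∧ (0 < d → code c' < code c) ∧
    val g c' = val g c * Z d

def Up (g : Fin n → H3) (d : ℕ) (c : List (Fin n)) : Prop :=
  ∃ c' : List (Fin n), c'.length = c.length ∧ val g c' = val g c * Z (-d)

lemma Down.zero (g : Fin n → H3) (c : List (Fin n)) : Down g 0 c :=
  ⟨c, rfl, le_rfl, by simp, by simp [Z_zero]⟩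
lemma Up.zero (g : Fin n → H3) (c : List (Fin n)) : Up g 0 c :=
  ⟨c, rfl, by simp [Z_zero]⟩

lemma mul_Z_mul (x y : H3) (j k : ℤ) : (x * Z j) * (y * Z k) = x * y * Z (j + k) := by
  rw [← Z_add, mul_assoc, ← mul_assoc (Z j), Z_comm j y]; simp only [mul_assoc]

lemma Down.add {g : Fin n → H3} {d e : ℕ} {u v : List (Fin n)} (hu : Down g d u)
    (hv : Down g e v) : Down g (d + e) (u ++ v) := by
  obtain ⟨u', h1, h2, h3, h4⟩ := hu
  obtain ⟨v', k1, k2, k3, k4⟩ := hv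
  refine ⟨u' ++ v', by simp [h1, k1], code_append_le k1 h2 k2, ?_, ?_⟩
  · intro h
    by_cases hd : 0 < d
    · exact code_append_lt k1 (h3 hd)
    · have := k3 (by omega)
      rw [code_append, code_append, k1]
      have := Nat.mul_le_mul_right (n ^ v.length) h2
      omega
  · rw [val_append, val_append, h4, k4, mul_Z_mul]; push_cast; rfl

lemma Up.add {g : Fin n → H3} {d e : ℕ} {u v : List (Fin n)} (hu : Up g d u)
    (hv : Up g e v) : Up g (d + e) (u ++ v) := by
  obtain ⟨u', h1, h4⟩ := hu
  obtain ⟨v', k1, k4⟩ := hv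
  refine ⟨u' ++ v', by simp [h1, k1], ?_⟩
  rw [val_append, val_append, h4, k4, mul_Z_mul]; congr 2; push_cast; ring

/-- first descent -/
lemma first_descent (c : List (Fin n)) : c.Pairwise (· ≤ ·) ∨
    ∃ p b a q, c = p ++ b :: a :: q ∧ (p ++ [b]).Pairwise (· ≤ ·) ∧ a < b := by
  induction c with
  | nil => left; simp
  | cons x c ih =>
    rcases c with _ | ⟨y, c⟩
    · left; simp
    rcases lt_or_ge y x with hxy | hxy
    · right
      exact ⟨[], x, y, c, rfl, by simp, hxy⟩
    · rcases ih with h | ⟨p, b, a, q, h1, h2, h3⟩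
      · left
        rw [List.pairwise_cons]
        refine ⟨?_, h⟩
        intro z hz
        rcases List.mem_cons.1 hz with rfl | hz
        · exact hxy
        · exact hxy.trans ((List.pairwise_cons.1 h).1 z hz)
      · right
        refine ⟨x :: p, b, a, q, by simp [h1], ?_, h3⟩
        rw [List.cons_append, List.pairwise_cons]
        refine ⟨?_, h2⟩
        intro z hz
        rcases p with _ | ⟨w, p⟩
        · simp at h1 hz
          rw [hz, ← h1.1]; exact hxy
        · simp only [List.cons_append, List.cons.injEq] at h1
          rw [List.cons_append] at h2 hz
          rcases List.mem_cons.1 hz with rfl | hz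
          · rw [← h1.1]; exact hxy
          · rw [h1.1] at hxy
            exact hxy.trans ((List.pairwise_cons.1 h2).1 z hz)

lemma code_swap {a b : Fin n} (h : a < b) (q : List (Fin n)) :
    code (a :: b :: q) < code (b :: a :: q) := by
  have h1 : code (a :: b :: q) = code ([a] ++ (b :: q)) := rfl
  have h2 : code (b :: a :: q) = code ([b] ++ (a :: q)) := rfl
  rw [h1, h2]
  exact code_append_lt (by simp) (by simpa [code] using h)

lemma val_swap (g : Fin n → H3) (x y : Fin n) (q : List (Fin n)) :
    val g (y :: x :: q) = val g (x :: y :: q) * Z (- dt (g x) (g y)) := by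
  simp only [val_cons]
  rw [← mul_assoc (g x), swap (g x) (g y), mul_assoc _ (Z _) (val g q), Z_comm]
  simp only [mul_assoc, Z_add, add_neg_cancel, Z_zero, mul_one]

lemma dt_neg (x y : H3) : - dt x y = dt y x := by simp [dt]

lemma code_prefix_lt (p : List (Fin n)) {u u' : List (Fin n)} (hl : u'.length = u.length)
    (h : code u' < code u) : code (p ++ u') < code (p ++ u) := by
  rw [code_append, code_append, hl]; omega

/-- a descent in a minimal word is strict -/
lemma strict_descent {g : Fin n → H3} (hg : ∀ i j, i ≤ j → 0 ≤ dt (g i) (g j))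
    {p q : List (Fin n)} {a b : Fin n} (hab : a < b) (hm : Mn g (p ++ b :: a :: q)) :
    0 < dt (g a) (g b) := by
  rcases (hg a b hab.le).lt_or_eq with h | h
  · exact h
  exfalso
  have hs := val_swap g b a q
  rw [dt_neg, ← h, Z_zero, mul_one] at hs
  have := hm (p ++ a :: b :: q) (by simp) (by rw [val_append, val_append, hs])
  exact absurd (code_prefix_lt p (by simp) (code_swap hab q)) (not_lt.2 this)

lemma exists_down {g : Fin n → H3} (hg : ∀ i j, i ≤ j → 0 ≤ dt (g i) (g j)) {D : ℕ}
    (hD : ∀ i j, dt (g i) (g j) ≤ D)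
    {c : List (Fin n)} (hm : Mn g c) (hc : ¬ Srt 1 c) : ∃ d, 0 < d ∧ d ≤ D ∧ Down g d c := by
  rcases first_descent c with h | ⟨p, b, a, q, rfl, -, hab⟩
  · exact absurd (Srt.of_sorted h) hc
  have h := strict_descent hg hab hm
  have hlt := code_prefix_lt p (by simp) (code_swap hab q)
  have hnat : ((dt (g a) (g b)).toNat : ℤ) = dt (g a) (g b) := Int.toNat_of_nonneg h.le
  refine ⟨(dt (g a) (g b)).toNat, by omega, ?_, p ++ a :: b :: q, by simp, hlt.le,
    fun _ => hlt, ?_⟩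
  · have := hD a b; omega
  · rw [val_append, val_append, val_swap g b a q, dt_neg, hnat, mul_assoc]

/-- no positive pair implies few sorted pieces -/
lemma no_pair {g : Fin n → H3} (hg : ∀ i j, i ≤ j → 0 ≤ dt (g i) (g j)) (k : ℕ) :
    ∀ (S : Finset (Fin n)), S.card = k → ∀ c : List (Fin n), (∀ x ∈ c, x ∈ S) → Mn g c →
      (c.Pairwise fun x y => dt (g x) (g y) ≤ 0) → Srt (k + 1) c := by
  induction k with
  | zero =>
    intro S hS c hc _ _
    have : c = [] := List.eq_nil_iff_forall_not_mem.2 fun x hx => by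
      have := hc x hx
      rw [Finset.card_eq_zero.1 hS] at this
      simp at this
    rw [this]; exact Srt_nil _
  | succ k ih =>
    intro S hS c hc hm hp
    rcases first_descent c with h | ⟨p, b, a, q, rfl, hpb, hab⟩
    · exact (Srt.of_sorted h).mono (by omega)
    have hs := strict_descent hg hab hm
    have e : p ++ b :: a :: q = (p ++ [b]) ++ (a :: q) := by simp
    rw [e] at hm hp hc ⊢
    have hbS : b ∈ S := hc b (by simp)
    have := ih (S.erase b) (by rw [Finset.card_erase_of_mem hbS, hS]; rfl) (a :: q) ?_ hm.right
      (List.pairwise_append.1 hp).2.1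
    · rw [add_comm (k + 1) 1]
      exact (Srt.of_sorted hpb).add this
    · intro x hx
      refine Finset.mem_erase.2 ⟨?_, hc x (by simp at hx ⊢; tauto)⟩
      rintro rfl
      have h2 := (List.pairwise_append.1 hp).2.1
      rw [List.pairwise_cons] at h2
      rcases List.mem_cons.1 hx with h | h
      · exact hab.ne h.symm
      · exact absurd (h2.1 _ h) (not_le.2 hs)

lemma exists_pair (r : Fin n → Fin n → Prop) (c : List (Fin n)) (h : ¬ c.Pairwise fun x y => ¬ r x y) :
    ∃ p x m y q, c = p ++ x :: (m ++ y :: q) ∧ r x y := by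
  induction c with
  | nil => simp at h
  | cons z c ih =>
    rw [List.pairwise_cons, not_and_or] at h
    rcases h with h | h
    · push Not at h
      obtain ⟨y, hy, hr⟩ := h
      obtain ⟨m, q, rfl⟩ := List.append_of_mem hy
      exact ⟨[], z, m, y, q, rfl, hr⟩
    · obtain ⟨p, x, m, y, q, rfl, hr⟩ := ih h
      exact ⟨z :: p, x, m, y, q, rfl, hr⟩

lemma exists_min_pair (r : Fin n → Fin n → Prop) (c : List (Fin n)) (k : ℕ) :
    ∀ p x m y q, m.length = k → c = p ++ x :: (m ++ y :: q) → r x y →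
    ∃ p x m y q, c = p ++ x :: (m ++ y :: q) ∧ r x y ∧ ∀ t ∈ m, ¬ r x t ∧ ¬ r t y := by
  induction k using Nat.strong_induction_on with
  | _ k ih =>
    intro p x m y q hk hc hr
    by_cases h : ∀ t ∈ m, ¬ r x t ∧ ¬ r t y
    · exact ⟨p, x, m, y, q, hc, hr, h⟩
    push Not at h
    obtain ⟨t, ht, h⟩ := h
    obtain ⟨m1, m2, rfl⟩ := List.append_of_mem ht
    by_cases h1 : r x t
    · exact ih m1.length (by simp at hk; omega) p x m1 t (m2 ++ y :: q) rfl (by simp [hc]) h1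
    · exact ih m2.length (by simp at hk; omega) (p ++ x :: m1) t m2 y q rfl (by simp [hc]) (h h1)

lemma val_comm (g : Fin n → H3) (x : Fin n) (m : List (Fin n))
    (h : ∀ t ∈ m, dt (g x) (g t) = 0) : g x * val g m = val g m * g x := by
  induction m with
  | nil => simp [val_nil]
  | cons t m ih =>
    rw [val_cons, ← mul_assoc, swap (g x) (g t), h t (by simp), Z_zero, mul_one, mul_assoc,
      ih fun s hs => h s (by simp [hs]), mul_assoc]

lemma exists_up {g : Fin n → H3} (hg : ∀ i j, i ≤ j → 0 ≤ dt (g i) (g j)) {D : ℕ}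
    (hD : ∀ i j, dt (g i) (g j) ≤ D) {l1 l2 : ℤ}
    (hl0 : l1 ≠ 0 ∨ l2 ≠ 0)
    (hl : ∀ i, 0 ≤ l1 * (g i).a + l2 * (g i).b)
    {c : List (Fin n)} (hm : Mn g c) (hc : ¬ Srt (n + 1) c) : ∃ d, 0 < d ∧ d ≤ D ∧ Up g d c := by
  have hpw : ¬ c.Pairwise fun x y => ¬ 0 < dt (g x) (g y) := by
    intro h
    refine hc (no_pair hg n Finset.univ (by simp) c (by simp) hm ?_)
    exact h.imp fun h => not_lt.1 h
  obtain ⟨p, x, m, y, q, h1, h2⟩ := exists_pair (fun x y => 0 < dt (g x) (g y)) c hpw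
  obtain ⟨p, x, m, y, q, h1, h, hmin⟩ := exists_min_pair (fun x y => 0 < dt (g x) (g y)) c
    m.length p x m y q rfl h1 h2
  simp only [not_lt] at hmin
  have hnat : ((dt (g x) (g y)).toNat : ℤ) = dt (g x) (g y) := Int.toNat_of_nonneg h.le
  refine ⟨(dt (g x) (g y)).toNat, by omega, by have := hD x y; omega, ?_⟩
  have pl : ∀ t, dt (g x) (g t) * (l1 * (g y).a + l2 * (g y).b) +
      dt (g t) (g y) * (l1 * (g x).a + l2 * (g x).b) =
      dt (g x) (g y) * (l1 * (g t).a + l2 * (g t).b) := by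
    intro t; simp only [dt]; ring
  have hx := hl x
  have hy := hl y
  have hor : 0 < l1 * (g y).a + l2 * (g y).b ∨ 0 < l1 * (g x).a + l2 * (g x).b := by
    by_contra hcon
    push Not at hcon
    have e1 : l1 * (g y).a + l2 * (g y).b = 0 := le_antisymm hcon.1 hy
    have e2 : l1 * (g x).a + l2 * (g x).b = 0 := le_antisymm hcon.2 hx
    have f1 : l1 * dt (g x) (g y) = 0 := by
      simp only [dt]; linear_combination (g y).b * e2 - (g x).b * e1
    have f2 : l2 * dt (g x) (g y) = 0 := by
      simp only [dt]; linear_combination (g x).a * e1 - (g y).a * e2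
    have hne := h.ne'
    rcases hl0 with h0 | h0
    · exact (mul_ne_zero h0 hne) f1
    · exact (mul_ne_zero h0 hne) f2
  subst h1
  rcases hor with hpos | hpos
  · have hz : ∀ t ∈ m, dt (g x) (g t) = 0 := by
      intro t ht
      have := hmin t ht
      have h3 := pl t
      have h4 := mul_nonneg h.le (hl t)
      have h5 := mul_nonpos_of_nonpos_of_nonneg this.2 hx
      refine le_antisymm this.1 (not_lt.1 fun hneg => ?_)
      have := mul_neg_of_neg_of_pos hneg hpos
      linarith
    refine ⟨p ++ (m ++ (y :: x :: q)), by simp; omega, ?_⟩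
    have e : val g (x :: (m ++ y :: q)) = val g (m ++ x :: y :: q) := by
      rw [val_cons, val_append, val_append, ← mul_assoc, val_comm g x m hz, val_cons g x, mul_assoc]
    rw [val_append, val_append g p (x :: _), e, val_append, val_append, val_swap g x y q, hnat]
    simp only [mul_assoc]
  · have hz : ∀ t ∈ m, dt (g y) (g t) = 0 := by
      intro t ht
      have := hmin t ht
      have h3 := pl t
      have h4 := mul_nonneg h.le (hl t)
      have h5 := mul_nonpos_of_nonpos_of_nonneg this.1 hy
      rw [← dt_neg, neg_eq_zero]
      refine le_antisymm this.2 (not_lt.1 fun hneg => ?_)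
      have := mul_neg_of_neg_of_pos hneg hpos
      linarith
    refine ⟨p ++ (y :: x :: (m ++ q)), by simp; omega, ?_⟩
    have e : val g (x :: (m ++ y :: q)) = val g (x :: y :: (m ++ q)) := by
      rw [val_cons, val_cons g x, val_cons, val_append, val_cons, val_append, ← mul_assoc (val g m),
        ← val_comm g y m hz, mul_assoc]
    rw [val_append, val_append g p (x :: _), e, val_swap g x y (m ++ q), hnat, mul_assoc]

/-! ### counting -/

/-- abstract pigeonhole: `Q` is `Down` or `Up` -/
lemma collect (g : Fin n → H3) (Q : ℕ → List (Fin n) → Prop) (T D : ℕ)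
    (h0 : ∀ c, Q 0 c) (hadd : ∀ d e u v, Q d u → Q e v → Q (d + e) (u ++ v))
    (hQ : ∀ c, Mn g c → ¬ Srt T c → ∃ d, 0 < d ∧ d ≤ D ∧ Q d c) (m : ℕ) :
    ∀ w, Mn g w → ¬ Srt (m * (T + 1)) w → ∃ t : ℕ → ℕ, ∑ d ∈ Finset.Icc 1 D, t d = m ∧
      ∀ d ∈ Finset.Icc 1 D, ∀ s ≤ t d, Q (s * d) w := by
  induction m with
  | zero => 
    intro w _ _
    refine ⟨fun _ => 0, by simp, ?_⟩
    intro d _ s hs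
    have : s = 0 := by simpa using hs
    subst this
    simpa using h0 w
  | succ m ih =>
    intro w hm hw
    rw [add_mul, one_mul, add_comm] at hw
    obtain ⟨u, v, rfl, hu, hv⟩ := split T (m * (T + 1)) w hw
    obtain ⟨e, he0, heD, he⟩ := hQ u hm.left hu
    obtain ⟨t, ht, hts⟩ := ih v hm.right hv
    refine ⟨fun d => t d + if d = e then 1 else 0, ?_, ?_⟩
    · rw [Finset.sum_add_distrib, ht, Finset.sum_ite_eq', if_pos (Finset.mem_Icc.2 ⟨he0, heD⟩)]
    · intro d hd s hs
      by_cases hst : s ≤ t d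
      · simpa using hadd _ _ _ _ (h0 u) (hts d hd s hst)
      · have hde : d = e := by
          by_contra hne
          simp [hne] at hs; omega
        subst hde
        simp at hs
        have : s = 1 + t d := by omega
        rw [this, add_mul, one_mul]
        exact hadd _ _ _ _ he (hts d hd _ le_rfl)

lemma collect' (g : Fin n → H3) (Q : ℕ → List (Fin n) → Prop) (T D : ℕ)
    (h0 : ∀ c, Q 0 c) (hadd : ∀ d e u v, Q d u → Q e v → Q (d + e) (u ++ v))
    (hQ : ∀ c, Mn g c → ¬ Srt T c → ∃ d, 0 < d ∧ d ≤ D ∧ Q d c)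
    (w : List (Fin n)) (hm : Mn g w) (hw : ¬ Srt ((D * D.factorial + 1) * (T + 1)) w) :
    Q D.factorial w := by
  obtain ⟨t, ht, hts⟩ := collect g Q T D h0 hadd hQ _ w hm hw
  have : ∃ d ∈ Finset.Icc 1 D, D.factorial ≤ t d := by
    by_contra hcon
    push Not at hcon
    have := Finset.sum_le_card_nsmul (Finset.Icc 1 D) t D.factorial fun d hd => (hcon d hd).le
    rw [ht] at this
    simp at this
  obtain ⟨d, hd, hle⟩ := this
  have hd' := Finset.mem_Icc.1 hd
  have := hts d hd (D.factorial / d) ((Nat.div_le_self _ _).trans hle)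
  rwa [Nat.div_mul_cancel (Nat.dvd_factorial hd'.1 hd'.2)] at this

theorem half_sorted (g : Fin n → H3) (hg : ∀ i j, i ≤ j → 0 ≤ dt (g i) (g j)) {l1 l2 : ℤ}
    (hl0 : l1 ≠ 0 ∨ l2 ≠ 0)
    (hl : ∀ i, 0 ≤ l1 * (g i).a + l2 * (g i).b) :
    Bd g (Submonoid.closure (Set.range g)) := by
  obtain ⟨D, hD⟩ : ∃ D : ℕ, ∀ i j, dt (g i) (g j) ≤ D := by
    refine ⟨∑ i, ∑ j, (dt (g i) (g j)).toNat, fun i j => ?_⟩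
    have h1 := Finset.single_le_sum (f := fun j => (dt (g i) (g j)).toNat)
      (fun _ _ => Nat.zero_le _) (Finset.mem_univ j)
    have h2 := Finset.single_le_sum (f := fun i => ∑ j, (dt (g i) (g j)).toNat)
      (fun _ _ => Nat.zero_le _) (Finset.mem_univ i)
    have := h1.trans h2
    have h3 := Int.self_le_toNat (dt (g i) (g j))
    omega
  set K := (D * D.factorial + 1) * (n + 1 + 1) with hK
  have main : ∀ w, Mn g w → Srt (K + 1 + K) w := by
    intro w hm
    by_contra hw
    obtain ⟨u, v, rfl, hu, hv⟩ := split K K w hw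
    have hdown := collect' g (Down g) (n + 1) D (Down.zero g) (fun _ _ _ _ h h' => h.add h')
      (fun c hc h => exists_down hg hD hc fun h' => h (h'.mono (by omega))) u hm.left hu
    have hup := collect' g (Up g) (n + 1) D (Up.zero g) (fun _ _ _ _ h h' => h.add h')
      (fun c hc h => exists_up hg hD hl0 hl hc h) v hm.right hv
    obtain ⟨u', h1, -, h3, h4⟩ := hdown
    obtain ⟨v', k1, k4⟩ := hup
    have := hm (u' ++ v') (by simp [h1, k1]) (by
      rw [val_append, val_append, h4, k4, mul_Z_mul, add_neg_cancel, Z_zero, mul_one])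
    exact absurd (code_append_lt k1 (h3 (Nat.factorial_pos D))) (not_lt.2 this)
  obtain ⟨L, hL⟩ := Srt_pat g (K + 1 + K)
  refine ⟨L, fun t ht => ?_⟩
  obtain ⟨w, rfl⟩ := exists_word g ht
  obtain ⟨w', hm, hv⟩ := exists_Mn g w
  rw [← hv]
  exact hL w' (main w' hm)

theorem half (g : Fin n → H3) {l1 l2 : ℤ} (hl0 : l1 ≠ 0 ∨ l2 ≠ 0)
    (hl : ∀ i, 0 ≤ l1 * (g i).a + l2 * (g i).b) :
    Bd g (Submonoid.closure (Set.range g)) := by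
  let lam : Fin n → ℤ := fun i => l1 * (g i).a + l2 * (g i).b
  let mu : Fin n → ℤ := fun i => l1 * (g i).b - l2 * (g i).a
  have hN : 0 < l1 ^ 2 + l2 ^ 2 := by
    rcases hl0 with h | h
    · have := sq_nonneg l2; have : 0 < l1 ^ 2 := by positivity
      linarith
    · have := sq_nonneg l1; have : 0 < l2 ^ 2 := by positivity
      linarith
  have hid : ∀ i j, (l1 ^ 2 + l2 ^ 2) * dt (g i) (g j) = lam i * mu j - mu i * lam j := by
    intro i j; simp only [lam, mu, dt]; ring
  let key : Fin n → ℕ ×ₗ ℚ := fun i =>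
    if 0 < lam i then toLex (1, (mu i : ℚ) / lam i) else
      if 0 < mu i then toLex (2, 0) else toLex (0, 0)
  have hkey : ∀ i j, key i ≤ key j → 0 ≤ dt (g i) (g j) := by
    intro i j hij
    have hi : 0 ≤ lam i := hl i
    have hj : 0 ≤ lam j := hl j
    suffices h : 0 ≤ lam i * mu j - mu i * lam j by
      rw [← hid] at h
      exact nonneg_of_mul_nonneg_right h hN
    simp only [key] at hij
    by_cases h1 : 0 < lam i <;> by_cases h2 : 0 < lam j
    · rw [if_pos h1, if_pos h2, Prod.Lex.toLex_le_toLex] at hij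
      simp at hij
      rw [div_le_div_iff₀ (by exact_mod_cast h1) (by exact_mod_cast h2)] at hij
      have : mu i * lam j ≤ mu j * lam i := by exact_mod_cast hij
      linarith
    · have h2' : lam j = 0 := by omega
      by_cases h3 : 0 < mu j
      · rw [h2']; nlinarith
      · rw [if_pos h1, if_neg h2, if_neg h3, Prod.Lex.toLex_le_toLex] at hij
        simp at hij
    · have h1' : lam i = 0 := by omega
      by_cases h3 : 0 < mu i
      · rw [if_neg h1, if_pos h2, if_pos h3, Prod.Lex.toLex_le_toLex] at hij
        simp at hij
      · rw [h1']; nlinarith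
    · have h1' : lam i = 0 := by omega
      have h2' : lam j = 0 := by omega
      simp [h1', h2']
  apply Bd_perm g (Tuple.sort key)
  exact half_sorted (g ∘ Tuple.sort key)
    (fun i j hij => hkey _ _ (Tuple.monotone_sort key hij)) hl0 (fun i => hl _)


/-! ### the group case -/

/-- scaled ordered product -/
def prd (g : Fin n → H3) (e : Fin n → ℕ) (L : List (Fin n)) : H3 :=
  (L.map fun i => g i ^ e i).prod

lemma prd_cons (g : Fin n → H3) (e : Fin n → ℕ) (i : Fin n) (L : List (Fin n)) :
    prd g e (i :: L) = g i ^ e i * prd g e L := by simp [prd]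
lemma prd_append (g : Fin n → H3) (e : Fin n → ℕ) (L L' : List (Fin n)) :
    prd g e (L ++ L') = prd g e L * prd g e L' := by simp [prd]
lemma prd_mem_pat (g : Fin n → H3) (e : Fin n → ℕ) (L : List (Fin n)) :
    prd g e L ∈ pat g L := by
  induction L with
  | nil => simp [prd, pat_nil]
  | cons i L ih =>
    rw [prd_cons, pat_cons]
    exact ⟨_, ⟨e i, rfl⟩, _, ih, rfl⟩
lemma prd_a (g : Fin n → H3) (e : Fin n → ℕ) (L : List (Fin n)) :
    (prd g e L).a = (L.map fun i => (e i : ℤ) * (g i).a).sum := by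
  induction L with
  | nil => simp [prd]
  | cons i L ih => rw [prd_cons]; simp [pow_a, ih]
lemma prd_b (g : Fin n → H3) (e : Fin n → ℕ) (L : List (Fin n)) :
    (prd g e L).b = (L.map fun i => (e i : ℤ) * (g i).b).sum := by
  induction L with
  | nil => simp [prd]
  | cons i L ih => rw [prd_cons]; simp [pow_b, ih]
lemma prd_univ_a (g : Fin n → H3) (e : Fin n → ℕ) :
    (prd g e (List.finRange n)).a = ∑ i, (e i : ℤ) * (g i).a := by
  rw [prd_a, ← List.ofFn_eq_map, List.sum_ofFn]
lemma prd_univ_b (g : Fin n → H3) (e : Fin n → ℕ) :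
    (prd g e (List.finRange n)).b = ∑ i, (e i : ℤ) * (g i).b := by
  rw [prd_b, ← List.ofFn_eq_map, List.sum_ofFn]

lemma sc_prd_rev (g : Fin n → H3) (e : Fin n → ℕ) (L : List (Fin n)) :
    sc (prd g e L) + sc (prd g e L.reverse) = 2 * (L.map fun i => (e i : ℤ) * sc (g i)).sum := by
  induction L with
  | nil => simp [prd, sc]
  | cons i L ih =>
    have e1 : prd g e [i] = g i ^ e i := by simp [prd]
    rw [List.reverse_cons, prd_cons, prd_append, sc_mul, sc_mul, e1, List.map_cons, List.sum_cons,
      sc_pow, mul_add, ← ih]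
    have ha : (prd g e L.reverse).a = (prd g e L).a := by
      rw [prd_a, prd_a, List.map_reverse, List.sum_reverse]
    have hb : (prd g e L.reverse).b = (prd g e L).b := by
      rw [prd_b, prd_b, List.map_reverse, List.sum_reverse]
    simp only [dt, ha, hb]
    ring

lemma eq_Z {x : H3} (ha : x.a = 0) (hb : x.b = 0) : x = Z x.c := by
  ext <;> simp [ha, hb]

lemma comm_pow (x y : H3) (j : ℤ) (k : ℕ) (h : ℤ) (hh : h = k * (j * dt x y)) :
    (y ^ j)⁻¹ * x ^ k * y ^ j = x ^ k * Z h := by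
  subst hh
  have hz : dt (x ^ k) (y ^ j) = k * (j * dt x y) := by
    have za : (y ^ j).a = j * y.a := by
      cases j with
      | ofNat m => simpa using pow_a y m
      | negSucc m => rw [zpow_negSucc, H3.inv_a, pow_a, Int.negSucc_eq]; push_cast; ring
    have zb : (y ^ j).b = j * y.b := by
      cases j with
      | ofNat m => simpa using pow_b y m
      | negSucc m => rw [zpow_negSucc, H3.inv_b, pow_b, Int.negSucc_eq]; push_cast; ring
    simp only [dt, pow_a, pow_b, za, zb]; ring
  rw [mul_assoc, swap (x ^ k) (y ^ j), hz, mul_assoc, inv_mul_cancel_left]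

/-- the positive relation -/
lemma relation (g : Fin n → H3)
    (H : ∀ l1 l2 : ℤ, (l1 ≠ 0 ∨ l2 ≠ 0) → ∃ i, l1 * (g i).a + l2 * (g i).b < 0) :
    ∃ m : Fin n → ℕ, (∀ i, 0 < m i) ∧ ∑ i, (m i : ℤ) * (g i).a = 0 ∧
      ∑ i, (m i : ℤ) * (g i).b = 0 := by
  have one : ∀ i, ∃ m : Fin n → ℕ, 0 < m i ∧ ∑ k, (m k : ℤ) * (g k).a = 0 ∧
      ∑ k, (m k : ℤ) * (g k).b = 0 := by
    intro i
    by_cases h0 : (g i).a = 0 ∧ (g i).b = 0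
    · refine ⟨Pi.single i 1, by simp, ?_, ?_⟩
      · rw [Finset.sum_eq_single i] <;> simp +contextual [h0.1]
      · rw [Finset.sum_eq_single i] <;> simp +contextual [h0.2]
    have triple : ∀ (j l : Fin n) (x y z : ℤ), 0 < x → 0 ≤ y → 0 ≤ z →
        x * (g i).a + y * (g j).a + z * (g l).a = 0 →
        x * (g i).b + y * (g j).b + z * (g l).b = 0 →
        ∃ m : Fin n → ℕ, 0 < m i ∧ ∑ k, (m k : ℤ) * (g k).a = 0 ∧
        ∑ k, (m k : ℤ) * (g k).b = 0 := by
      intro j l x y z hx hy hz ha hb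
      lift x to ℕ using hx.le
      lift y to ℕ using hy
      lift z to ℕ using hz
      refine ⟨fun k => (if k = i then x else 0) + (if k = j then y else 0) +
        (if k = l then z else 0), ?_, ?_, ?_⟩
      · have : 0 < x := by exact_mod_cast hx
        simp; omega
      · push_cast
        simp only [add_mul, Finset.sum_add_distrib, ite_mul, zero_mul, Finset.sum_ite_eq',
          Finset.mem_univ, if_true]
        exact ha
      · push_cast
        simp only [add_mul, Finset.sum_add_distrib, ite_mul, zero_mul, Finset.sum_ite_eq',
          Finset.mem_univ, if_true]
        exact hb
    let S : Finset (Fin n) := Finset.univ.filter fun j => dt (g i) (g j) < 0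
    have hS : S.Nonempty := by
      obtain ⟨j, hj⟩ := H (-(g i).b) (g i).a (by
        by_contra hc; push Not at hc; exact h0 ⟨hc.2, by simpa using hc.1⟩)
      have hj2 : dt (g i) (g j) < 0 := by simp only [dt]; linarith
      exact ⟨j, by simpa [S] using hj2⟩
    let dot : Fin n → ℤ := fun j => (g i).a * (g j).a + (g i).b * (g j).b
    obtain ⟨j, hjS, hj⟩ := S.exists_max_image
      (fun j => (dot j : ℚ) / (dt (g i) (g j) : ℤ)) hS
    have hij : dt (g i) (g j) < 0 := by simpa [S] using hjS
    have hN : 0 < (g i).a ^ 2 + (g i).b ^ 2 := by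
      rcases not_and_or.1 h0 with h | h
      · have := sq_nonneg (g i).b; have : 0 < (g i).a ^ 2 := by positivity
        linarith
      · have := sq_nonneg (g i).a; have : 0 < (g i).b ^ 2 := by positivity
        linarith
    have ext : ∀ k, dt (g i) (g k) < 0 → 0 ≤ dt (g j) (g k) := by
      intro k hk
      have h1 := hj k (by simpa [S] using hk)
      have hj' : ((dt (g i) (g j) : ℤ) : ℚ) < 0 := by exact_mod_cast hij
      have hk' : ((dt (g i) (g k) : ℤ) : ℚ) < 0 := by exact_mod_cast hk
      rw [← neg_div_neg_eq, ← neg_div_neg_eq (dot j : ℚ),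
        div_le_div_iff₀ (by linarith) (by linarith)] at h1
      have h2 : dot k * dt (g i) (g j) ≤ dot j * dt (g i) (g k) := by
        have : (dot k : ℚ) * (dt (g i) (g j) : ℤ) ≤ dot j * (dt (g i) (g k) : ℤ) := by linarith
        exact_mod_cast this
      have h3 : ((g i).a ^ 2 + (g i).b ^ 2) * dt (g j) (g k) =
          dot j * dt (g i) (g k) - dot k * dt (g i) (g j) := by
        simp only [dot, dt]; ring
      refine nonneg_of_mul_nonneg_right ?_ hN
      rw [h3]; linarith
    obtain ⟨l, hl⟩ := H (-(g j).b) (g j).a (by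
      by_contra hc; push Not at hc
      have : (g j).b = 0 := by simpa using hc.1
      simp [dt, hc.2, this] at hij)
    have hjl : dt (g j) (g l) < 0 := by simp only [dt]; linarith
    have hil : 0 ≤ dt (g i) (g l) := by
      by_contra hc
      exact absurd (ext l (not_le.1 hc)) (not_le.2 hjl)
    refine triple j l (-dt (g j) (g l)) (dt (g i) (g l)) (-dt (g i) (g j)) (by linarith) hil
      (by linarith) ?_ ?_ <;> simp only [dt] <;> ring
  choose m hm ha hb using one
  refine ⟨fun k => ∑ i, m i k, ?_, ?_, ?_⟩
  · intro i
    exact (hm i).trans_le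
      (Finset.single_le_sum (f := fun j => m j i) (fun _ _ => Nat.zero_le _) (Finset.mem_univ i))
  · push_cast
    simp only [Finset.sum_mul]
    rw [Finset.sum_comm]
    exact Finset.sum_eq_zero fun i _ => ha i
  · push_cast
    simp only [Finset.sum_mul]
    rw [Finset.sum_comm]
    exact Finset.sum_eq_zero fun i _ => hb i

lemma prd_mem (g : Fin n → H3) (e : Fin n → ℕ) (L : List (Fin n)) :
    prd g e L ∈ Submonoid.closure (Set.range g) := pat_le g L (prd_mem_pat g e L)

/-- partial inverses -/
lemma partial_inv (g : Fin n → H3) (m : Fin n → ℕ)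
    (ha : ∑ i, (m i : ℤ) * (g i).a = 0) (hb : ∑ i, (m i : ℤ) * (g i).b = 0) (i : Fin n) :
    ∃ X ∈ Submonoid.closure (Set.range g), ∃ s, g i ^ m i * X = Z s := by
  obtain ⟨L1, L2, hL⟩ := List.append_of_mem (List.mem_finRange i)
  have h := eq_Z (x := prd g m (List.finRange n)) (by rw [prd_univ_a, ha]) (by rw [prd_univ_b, hb])
  generalize (prd g m (List.finRange n)).c = c at h
  refine ⟨prd g m L2 * prd g m L1, mul_mem (prd_mem _ _ _) (prd_mem _ _ _), c, ?_⟩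
  rw [← mul_assoc, ← prd_cons]
  rw [hL, prd_append] at h
  have h2 : prd g m (i :: L2) = (prd g m L1)⁻¹ * Z c := by
    rw [← h]; group
  rw [h2, mul_assoc, Z_comm, inv_mul_cancel_left]

lemma both_signs (M : Submonoid H3) {P P' Q Q' : H3} (hP : P ∈ M) (hP' : P' ∈ M) (hQ : Q ∈ M)
    (hQ' : Q' ∈ M) {s t : ℤ} (h1 : P * P' = Z s) (h2 : Q * Q' = Z t) (hd : 0 < dt P Q) :
    ∃ e : ℤ, 0 < e ∧ Z e ∈ M := by
  let k : ℕ := (|s| + |t| + 1).toNat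
  have hk : (k : ℤ) = |s| + |t| + 1 := Int.toNat_of_nonneg (by positivity)
  have a1 : P'.a = -P.a := by have := congrArg H3.a h1; simp at this; linarith
  have b1 : P'.b = -P.b := by have := congrArg H3.b h1; simp at this; linarith
  have a2 : Q'.a = -Q.a := by have := congrArg H3.a h2; simp at this; linarith
  have b2 : Q'.b = -Q.b := by have := congrArg H3.b h2; simp at this; linarith
  have c1 : Commute P P' := by
    have : P * P' = P' * P := by
      rw [swap]; have : dt P P' = 0 := by simp only [dt, a1, b1]; ring
      rw [this, Z_zero, mul_one]
    exact this
  have c2 : Commute Q Q' := by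
    have : Q * Q' = Q' * Q := by
      rw [swap]; have : dt Q Q' = 0 := by simp only [dt, a2, b2]; ring
      rw [this, Z_zero, mul_one]
    exact this
  have e1 : P ^ k * P' ^ k = Z (k * s) := by rw [← c1.mul_pow, h1, Z_pow]
  have e2 : Q ^ k * Q' ^ k = Z (k * t) := by rw [← c2.mul_pow, h2, Z_pow]
  refine ⟨k * k * dt P Q + k * s + k * t, ?_, ?_⟩
  · have h3 := neg_abs_le s
    have h4 := neg_abs_le t
    have hk1 : (0 : ℤ) < k := by rw [hk]; positivity
    have : (k : ℤ) * dt P Q + s + t > 0 := by nlinarith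
    nlinarith
  · have : P ^ k * Q ^ k * P' ^ k * Q' ^ k = Z (k * k * dt P Q + k * s + k * t) := by
      have hdk : dt (P ^ k) (Q ^ k) = k * k * dt P Q := by
        simp only [dt, pow_a, pow_b]; ring
      calc P ^ k * Q ^ k * P' ^ k * Q' ^ k
          = Q ^ k * P ^ k * Z (k * k * dt P Q) * P' ^ k * Q' ^ k := by
            rw [swap (P ^ k) (Q ^ k), hdk]
        _ = Q ^ k * (P ^ k * P' ^ k) * Q' ^ k * Z (k * k * dt P Q) := by
            simp only [mul_assoc]; rw [Z_comm]; simp only [mul_assoc]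
        _ = (Q ^ k * Q' ^ k) * Z (k * s) * Z (k * k * dt P Q) := by
            rw [e1]; simp only [mul_assoc]; rw [← mul_assoc (Z _) (Q' ^ k), Z_comm]
            simp only [mul_assoc]
        _ = _ := by rw [e2, Z_add, Z_add]; congr 1; ring
    rw [← this]
    exact mul_mem (mul_mem (mul_mem (pow_mem hP k) (pow_mem hQ k)) (pow_mem hP' k)) (pow_mem hQ' k)

lemma both_signs' (M : Submonoid H3) {P P' Q Q' : H3} (hP : P ∈ M) (hP' : P' ∈ M) (hQ : Q ∈ M)
    (hQ' : Q' ∈ M) {s t : ℤ} (h1 : P * P' = Z s) (h2 : Q * Q' = Z t) (hd : 0 < dt P Q) :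
    ∃ e : ℤ, 0 < e ∧ Z (-e) ∈ M := by
  let k : ℕ := (|s| + |t| + 1).toNat
  have hk : (k : ℤ) = |s| + |t| + 1 := Int.toNat_of_nonneg (by positivity)
  have a1 : P'.a = -P.a := by have := congrArg H3.a h1; simp at this; linarith
  have b1 : P'.b = -P.b := by have := congrArg H3.b h1; simp at this; linarith
  have e1 : P' ^ k = (P ^ k)⁻¹ * Z (k * s) := by
    rw [← Z_pow, ← h1]
    have c1 : Commute P P' := by
      have : P * P' = P' * P := by
        rw [swap]; have : dt P P' = 0 := by simp only [dt, a1, b1]; ring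
        rw [this, Z_zero, mul_one]
      exact this
    rw [c1.mul_pow, inv_mul_cancel_left]
  have e2 : Q' ^ k = (Q ^ k)⁻¹ * Z (k * t) := by
    have a2 : Q'.a = -Q.a := by have := congrArg H3.a h2; simp at this; linarith
    have b2 : Q'.b = -Q.b := by have := congrArg H3.b h2; simp at this; linarith
    rw [← Z_pow, ← h2]
    have c2 : Commute Q Q' := by
      have : Q * Q' = Q' * Q := by
        rw [swap]; have : dt Q Q' = 0 := by simp only [dt, a2, b2]; ring
        rw [this, Z_zero, mul_one]
      exact this
    rw [c2.mul_pow, inv_mul_cancel_left]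
  refine ⟨k * k * dt P Q - k * s - k * t, ?_, ?_⟩
  · have h3 := le_abs_self s
    have h4 := le_abs_self t
    have hk1 : (0 : ℤ) < k := by rw [hk]; positivity
    have : (k : ℤ) * dt P Q - s - t > 0 := by nlinarith
    nlinarith
  · have : Q ^ k * P ^ k * Q' ^ k * P' ^ k = Z (-(k * k * dt P Q - k * s - k * t)) := by
      rw [e1, e2]
      ext <;> simp [pow_a, pow_b, dt] <;> ring
    rw [← this]
    exact mul_mem (mul_mem (mul_mem (pow_mem hQ k) (pow_mem hP k)) (pow_mem hQ' k)) (pow_mem hP' k)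

lemma Z_neg_mem (M : Submonoid H3) {e f s : ℤ} (he : 0 < e) (hf : 0 < f) (h1 : Z e ∈ M)
    (h2 : Z (-f) ∈ M) (hs : Z s ∈ M) : Z (-s) ∈ M := by
  have key : ∀ x y : ℕ, ∀ w : ℤ, w = x * s + y * (if 0 ≤ s then -f else e) → Z w ∈ M := by
    intro x y w hw
    have : Z w = Z s ^ x * Z (if 0 ≤ s then -f else e) ^ y := by
      rw [Z_pow, Z_pow, Z_add, hw]
    rw [this]
    refine mul_mem (pow_mem hs x) (pow_mem ?_ y)
    split_ifs <;> assumption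
  by_cases h : 0 ≤ s
  · refine key (f.toNat - 1) s.toNat _ ?_
    rw [if_pos h]
    have h3 : ((f.toNat - 1 : ℕ) : ℤ) = f - 1 := by omega
    rw [h3, Int.toNat_of_nonneg h]; ring
  · refine key (e.toNat - 1) (-s).toNat _ ?_
    rw [if_neg h]
    have h3 : ((e.toNat - 1 : ℕ) : ℤ) = e - 1 := by omega
    rw [h3, Int.toNat_of_nonneg (by omega)]; ring

theorem group_case (g : Fin n → H3)
    (H : ∀ l1 l2 : ℤ, (l1 ≠ 0 ∨ l2 ≠ 0) → ∃ i, l1 * (g i).a + l2 * (g i).b < 0) :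
    Bd g (Submonoid.closure (Set.range g)) := by
  obtain ⟨m, hm, ha, hb⟩ := relation g H
  set M := Submonoid.closure (Set.range g) with hM
  have hgM : ∀ i, g i ∈ M := fun i => Submonoid.subset_closure ⟨i, rfl⟩
  -- noncommuting pair
  obtain ⟨p, q, hpq⟩ : ∃ p q, 0 < dt (g p) (g q) := by
    obtain ⟨q, hq⟩ := H 1 0 (by simp)
    obtain ⟨p, hp⟩ := H ((g q).b) (-(g q).a) (by right; simp at hq ⊢; omega)
    exact ⟨q, p, by simp only [dt]; linarith⟩
  have hdpq : 0 < dt (g p ^ m p) (g q ^ m q) := by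
    have : dt (g p ^ m p) (g q ^ m q) = m p * m q * dt (g p) (g q) := by
      simp only [dt, pow_a, pow_b]; ring
    rw [this]
    have h1 : (0 : ℤ) < m p := by exact_mod_cast hm p
    have h2 : (0 : ℤ) < m q := by exact_mod_cast hm q
    positivity
  have pinv := partial_inv g m ha hb
  obtain ⟨P', hP', s, hs⟩ := pinv p
  obtain ⟨Q', hQ', t, ht⟩ := pinv q
  obtain ⟨e, he, heM⟩ := both_signs M (pow_mem (hgM p) _) hP' (pow_mem (hgM q) _) hQ' hs ht hdpq
  obtain ⟨f, hf, hfM⟩ := both_signs' M (pow_mem (hgM p) _) hP' (pow_mem (hgM q) _) hQ' hs ht hdpq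
  -- `M` is a group
  have hinvg : ∀ i, (g i)⁻¹ ∈ M := by
    intro i
    obtain ⟨X, hX, s, hs⟩ := pinv i
    have hsM : Z s ∈ M := hs ▸ mul_mem (pow_mem (hgM i) _) hX
    have hsM' := Z_neg_mem M he hf heM hfM hsM
    have : (g i)⁻¹ = g i ^ (m i - 1) * X * Z (-s) := by
      rw [inv_eq_iff_mul_eq_one, ← mul_assoc, ← mul_assoc, ← pow_succ',
        Nat.sub_add_cancel (hm i), hs, Z_add, add_neg_cancel, Z_zero]
    rw [this]
    exact mul_mem (mul_mem (pow_mem (hgM i) _) hX) hsM'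
  have hinv : ∀ x ∈ M, x⁻¹ ∈ M := by
    intro x hx
    induction hx using Submonoid.closure_induction with
    | mem x hx => obtain ⟨i, rfl⟩ := hx; exact hinvg i
    | one => simp
    | mul x y _ _ hx hy => rw [mul_inv_rev]; exact mul_mem hy hx
  have hzpow : ∀ x ∈ M, ∀ j : ℤ, x ^ j ∈ M := by
    intro x hx j
    cases j with
    | ofNat k => simpa using pow_mem hx k
    | negSucc k => rw [zpow_negSucc]; exact hinv _ (pow_mem hx _)
  -- bounded central elements
  obtain ⟨L1, L2, hL⟩ := List.append_of_mem (List.mem_finRange p)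
  set C : ℤ := ((List.finRange n).map fun i => (m i : ℤ) * sc (g i)).sum with hC
  have hZ : ∀ j : ℤ, Bd g (Set.range fun k : ℕ => Z (k * (C + m p * (j * dt (g p) (g q))))) := by
    intro j
    have hpatB : ∀ L, Bd g (pat g L) := fun L => ⟨L, le_rfl⟩
    have b := (((((hpatB L1).mul (Bd.single (hinv _ (hzpow _ (hgM q) j)))).mul
      (Bd.pows g p)).mul (Bd.single (hzpow _ (hgM q) j))).mul (hpatB L2)).mul
      (hpatB (List.finRange n).reverse)
    refine b.mono ?_
    rintro _ ⟨k, rfl⟩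
    let E : Fin n → ℕ := fun i => k * m i
    have : Z (k * (C + m p * (j * dt (g p) (g q)))) =
        prd g E L1 * (g q ^ j)⁻¹ * g p ^ E p * g q ^ j * prd g E L2 *
          prd g E (List.finRange n).reverse := by
      have hc := comm_pow (g p) (g q) j (E p) _ rfl
      have h1 : prd g E L1 * (g q ^ j)⁻¹ * g p ^ E p * g q ^ j * prd g E L2 =
          prd g E (List.finRange n) * Z (E p * (j * dt (g p) (g q))) := by
        rw [hL, prd_append, prd_cons]
        rw [mul_assoc (prd g E L1), mul_assoc (prd g E L1), hc]
        simp only [mul_assoc]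
        rw [Z_comm]
      have hUa : (prd g E (List.finRange n)).a = 0 := by
        rw [prd_univ_a]; simp only [E]; push_cast; simp only [mul_assoc]
        rw [← Finset.mul_sum, ha, mul_zero]
      have hUb : (prd g E (List.finRange n)).b = 0 := by
        rw [prd_univ_b]; simp only [E]; push_cast; simp only [mul_assoc]
        rw [← Finset.mul_sum, hb, mul_zero]
      have hRa : (prd g E (List.finRange n).reverse).a = 0 := by
        rw [← hUa, prd_a, prd_a, List.map_reverse, List.sum_reverse]
      have hRb : (prd g E (List.finRange n).reverse).b = 0 := by
        rw [← hUb, prd_b, prd_b, List.map_reverse, List.sum_reverse]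
      have hsc := sc_prd_rev g E (List.finRange n)
      have hkC : ((List.finRange n).map fun i => (E i : ℤ) * sc (g i)).sum = k * C := by
        rw [hC, ← List.sum_map_mul_left]
        congr 1
        apply List.map_congr_left
        intro i _
        simp only [E]; push_cast; ring
      rw [hkC] at hsc
      simp only [sc, hUa, hRa] at hsc
      rw [h1, eq_Z hUa hUb, eq_Z hRa hRb, Z_add, Z_add]
      congr 1
      simp only [E]; push_cast
      linarith
    simp only
    rw [this]
    exact Set.mul_mem_mul (Set.mul_mem_mul (Set.mul_mem_mul (Set.mul_mem_mul (Set.mul_mem_mul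
      (prd_mem_pat _ _ _) rfl) ⟨_, rfl⟩) rfl) (prd_mem_pat _ _ _)) (prd_mem_pat _ _ _)
  have hmd : 1 ≤ m p * dt (g p) (g q) := by
    have h1 : (0 : ℤ) < m p := by exact_mod_cast hm p
    have : 0 < m p * dt (g p) (g q) := by positivity
    linarith
  obtain ⟨E1, hE1, hB1⟩ : ∃ E1 : ℤ, 0 < E1 ∧ Bd g (Set.range fun k : ℕ => Z (k * E1)) := by
    refine ⟨_, ?_, hZ (|C| + 1)⟩
    have := neg_abs_le C
    have h2 := abs_nonneg C
    nlinarith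
  obtain ⟨E2, hE2, hB2⟩ : ∃ E2 : ℤ, 0 < E2 ∧ Bd g (Set.range fun k : ℕ => Z (k * (-E2))) := by
    refine ⟨-(C + m p * (-(|C| + 1) * dt (g p) (g q))), ?_, ?_⟩
    · have := le_abs_self C
      have h2 := abs_nonneg C
      nlinarith
    · rw [neg_neg]; exact hZ _
  set E := E1 * E2 with hE
  have hE0 : 0 < E := mul_pos hE1 hE2
  have hBE : Bd g (Set.range fun k : ℤ => Z (k * E)) := by
    refine (hB1.union hB2).mono ?_
    rintro _ ⟨k, rfl⟩
    rcases le_total 0 k with h | h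
    · left
      refine ⟨(k * E2).toNat, ?_⟩
      simp only
      rw [Int.toNat_of_nonneg (by positivity), hE]; congr 1; ring
    · right
      refine ⟨(-k * E1).toNat, ?_⟩
      simp only
      rw [Int.toNat_of_nonneg (mul_nonneg (by omega) hE1.le), hE]; congr 1; ring
  have hZEM : ∀ k : ℤ, Z (k * E) ∈ M := by
    obtain ⟨L, hL⟩ := hBE
    exact fun k => pat_le g L (hL ⟨k, rfl⟩)
  let R : Set H3 := {x | x ∈ M ∧ ∃ r : ℤ, r ∈ Set.Ico 0 E ∧ x = Z r}
  have hR : Bd g R := by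
    refine Bd.finite ?_ fun x hx => hx.1
    refine ((Set.finite_Ico 0 E).image Z).subset ?_
    rintro x ⟨_, r, hr, rfl⟩
    exact ⟨r, hr, rfl⟩
  have hall : Bd g (pat g (List.finRange n)) := ⟨_, le_rfl⟩
  refine ((hall.mul hBE).mul hR).mono ?_
  intro t ht
  obtain ⟨k, hka, hkb⟩ : ∃ k : Fin n → ℕ, t.a = ∑ i, (k i : ℤ) * (g i).a ∧
      t.b = ∑ i, (k i : ℤ) * (g i).b := by
    have ht' : t ∈ M := ht
    clear ht
    induction ht' using Submonoid.closure_induction with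
    | mem x hx =>
      obtain ⟨i, rfl⟩ := hx
      exact ⟨fun k => if k = i then 1 else 0, by simp, by simp⟩
    | one => exact ⟨0, by simp, by simp⟩
    | mul x y _ _ hx hy =>
      obtain ⟨k, h1, h2⟩ := hx
      obtain ⟨k', h3, h4⟩ := hy
      refine ⟨k + k', ?_, ?_⟩
      · simp [h1, h3, add_mul, Finset.sum_add_distrib]
      · simp [h2, h4, add_mul, Finset.sum_add_distrib]
  set W := prd g k (List.finRange n) with hW
  have hWM : W ∈ M := prd_mem _ _ _
  have htW := eq_mul_Z (x := t) (y := W) (by rw [hka, hW, prd_univ_a]) (by rw [hkb, hW, prd_univ_b])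
  set c := t.c - W.c with hc
  have hcM : Z c ∈ M := by
    have : Z c = W⁻¹ * t := by rw [htW, inv_mul_cancel_left]
    rw [this]; exact mul_mem (hinv _ hWM) ht
  have hdiv : Z c = Z (c / E * E) * Z (c % E) := by
    rw [Z_add, mul_comm, Int.mul_ediv_add_emod]
  refine ⟨W * Z (c / E * E), ⟨W, prd_mem_pat _ _ _, _, ⟨c / E, rfl⟩, rfl⟩, Z (c % E), ⟨?_, c % E,
    ⟨Int.emod_nonneg _ hE0.ne', Int.emod_lt_of_pos _ hE0⟩, rfl⟩, ?_⟩
  · have : Z (c % E) = (Z (c / E * E))⁻¹ * Z c := by rw [hdiv, inv_mul_cancel_left]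
    rw [this]; exact mul_mem (hinv _ (hZEM _)) hcM
  · simp only
    rw [mul_assoc, ← hdiv, ← htW]

end H3P

theorem stmt_15 (n : ℕ) (g : Fin n → H3) :
    ∃ (N : ℕ) (h : Fin N → H3),
      (∀ j, ∃ i, h j = g i) ∧
      (Submonoid.closure (Set.range g) : Set H3) =
        {t : H3 | ∃ s : Fin N → ℕ, (List.ofFn fun j => h j ^ s j).prod = t} := by
  apply H3P.final_of_Bd
  by_cases H : ∃ l1 l2 : ℤ, (l1 ≠ 0 ∨ l2 ≠ 0) ∧ ∀ i, 0 ≤ l1 * (g i).a + l2 * (g i).b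
  · obtain ⟨l1, l2, h0, h⟩ := H
    exact H3P.half g h0 h
  · apply H3P.group_case g
    intro l1 l2 h0
    by_contra hc
    push Not at hc
    exact H ⟨l1, l2, h0, hc⟩
end
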